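/- arXiv:1709.04508 — 3 statements merged into one kernel-verified Lean document; each statement's English description precedes it below -/
import Mathlib

section
/- Let n>1 and let 𝔸 be a ℂ-elliptic homogeneous linear constant-coefficient differential operator of order k on ℝⁿ from V to W. Then for every 1 ≤ p ≤ ∞ and every 1 ≤ l ≤ k−1 there exists a constant c > 0 such that for all u ∈ C^∞(cl(B), V), ‖D^l u‖_{L^p(B)} ≤ c ( ‖u‖_{L^p(B)} + ‖𝔸u‖_{L^p(B)} ). -/
noncomputable section

open MeasureTheory Metric
open scoped ENNReal RealInnerProductSpace

/-- Euclidean space `ℝⁿ`. -/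
abbrev Euc (n : ℕ) : Type := EuclideanSpace ℝ (Fin n)

/-- The coefficient datum of a homogeneous `k`-th order linear constant-coefficient
differential operator `𝔸` from `V` to `W` on `ℝⁿ`: a linear map acting on the space of
(values of) `k`-th derivatives, so that `𝔸 u (x) = A (D^k u (x))`. -/
abbrev OpCoeff (n k : ℕ) (V W : Type*) [NormedAddCommGroup V] [NormedSpace ℝ V]
    [NormedAddCommGroup W] [NormedSpace ℝ W] : Type _ :=
  ContinuousMultilinearMap ℝ (fun _ : Fin k => Euc n) V →L[ℝ] W

variable {n k : ℕ} {V W : Type*}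
  [NormedAddCommGroup V] [InnerProductSpace ℝ V] [FiniteDimensional ℝ V]
  [NormedAddCommGroup W] [InnerProductSpace ℝ W] [FiniteDimensional ℝ W]

/-- `𝔸 u`, the operator applied to `u : ℝⁿ → V`. -/
def opApply (A : OpCoeff n k V W) (u : Euc n → V) (x : Euc n) : W :=
  A (iteratedFDeriv ℝ k u x)

/-- The symmetric tensor `v ⊗^k ξ`, i.e. the `k`-linear map `(e₁,…,e_k) ↦ (∏ᵢ ⟪ξ,eᵢ⟫) • v`. -/
def symTensor (n k : ℕ) {V : Type*} [NormedAddCommGroup V] [NormedSpace ℝ V]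
    (ξ : Euc n) (v : V) : ContinuousMultilinearMap ℝ (fun _ : Fin k => Euc n) V :=
  (ContinuousMultilinearMap.mkPiRing ℝ (Fin k) v).compContinuousLinearMap
    (fun _ => innerSL ℝ ξ)

/-- The (real) symbol `𝔸[ξ] v = A (v ⊗^k ξ)`. -/
def symbol (A : OpCoeff n k V W) (ξ : Euc n) (v : V) : W :=
  A (symTensor n k ξ v)

/-- Ellipticity: `𝔸[ξ]` is injective for every real `ξ ≠ 0`. -/
def IsElliptic (A : OpCoeff n k V W) : Prop :=
  ∀ ξ : Euc n, ξ ≠ 0 → Function.Injective (symbol A ξ)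

/-- Cancellation: `⋂_{ξ ≠ 0} 𝔸[ξ](V) = {0}`. -/
def IsCancelling (A : OpCoeff n k V W) : Prop :=
  (⋂ ξ ∈ {ξ : Euc n | ξ ≠ 0}, Set.range (symbol A ξ)) = {0}

/-- The scalar `ℝ`-multilinear map `(e₁,…,e_k) ↦ ∏ᵢ (⟪η₁,eᵢ⟫ + i ⟪η₂,eᵢ⟫) ∈ ℂ`,
the building block for the complexified symbol at `ξ = η₁ + i η₂`. -/
def cxKernel (n k : ℕ) (η₁ η₂ : Euc n) :
    ContinuousMultilinearMap ℝ (fun _ : Fin k => Euc n) ℂ :=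
  ((ContinuousMultilinearMap.mkPiRing ℂ (Fin k) (1 : ℂ)).restrictScalars ℝ).compContinuousLinearMap
    (fun _ => Complex.ofRealCLM.comp (innerSL ℝ η₁) + Complex.I • Complex.ofRealCLM.comp (innerSL ℝ η₂))

/-- Real part of the complexified tensor `(v₁ + i v₂) ⊗^k (η₁ + i η₂)`. -/
def cxSymTensorRe (n k : ℕ) {V : Type*} [NormedAddCommGroup V] [NormedSpace ℝ V]
    (η₁ η₂ : Euc n) (v₁ v₂ : V) : ContinuousMultilinearMap ℝ (fun _ : Fin k => Euc n) V :=
  (Complex.reCLM.compContinuousMultilinearMap (cxKernel n k η₁ η₂)).smulRight v₁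
    - (Complex.imCLM.compContinuousMultilinearMap (cxKernel n k η₁ η₂)).smulRight v₂

/-- Imaginary part of the complexified tensor `(v₁ + i v₂) ⊗^k (η₁ + i η₂)`. -/
def cxSymTensorIm (n k : ℕ) {V : Type*} [NormedAddCommGroup V] [NormedSpace ℝ V]
    (η₁ η₂ : Euc n) (v₁ v₂ : V) : ContinuousMultilinearMap ℝ (fun _ : Fin k => Euc n) V :=
  (Complex.imCLM.compContinuousMultilinearMap (cxKernel n k η₁ η₂)).smulRight v₁
    + (Complex.reCLM.compContinuousMultilinearMap (cxKernel n k η₁ η₂)).smulRight v₂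

/-- ℂ-ellipticity: the complexified symbol `𝔸[η₁ + i η₂]` is injective on `V + iV` for
every nonzero complex frequency `η₁ + i η₂`. -/
def IsCElliptic (A : OpCoeff n k V W) : Prop :=
  ∀ η₁ η₂ : Euc n, ∀ v₁ v₂ : V, (η₁, η₂) ≠ 0 →
    A (cxSymTensorRe n k η₁ η₂ v₁ v₂) = 0 → A (cxSymTensorIm n k η₁ η₂ v₁ v₂) = 0 →
      v₁ = 0 ∧ v₂ = 0

/-- The null-space of `𝔸`: smooth maps `u : ℝⁿ → V` with `𝔸 u = 0`. -/
def nullSpace (A : OpCoeff n k V W) : Set (Euc n → V) :=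
  {u | ContDiff ℝ (⊤ : ℕ∞) u ∧ ∀ x, opApply A u x = 0}

open MvPolynomial in
/-- Nullstellensatz consequence. -/
theorem ce_alg {n : ℕ} {d e : Type} [Fintype d] [DecidableEq d] [Fintype e] [DecidableEq e]
    (M : Matrix e d (MvPolynomial (Fin n) ℂ))
    (hM : ∀ ξ : Fin n → ℂ, ξ ≠ 0 → ∀ v : d → ℂ,
      (M.map (aeval ξ)).mulVec v = 0 → v = 0) :
    ∃ m0 : ℕ, ∀ β : Fin n →₀ ℕ, m0 ≤ β.degree →
      ∃ B : Matrix d e (MvPolynomial (Fin n) ℂ),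
        B * M = (monomial β (1 : ℂ)) • (1 : Matrix d d (MvPolynomial (Fin n) ℂ)) := by
  classical
  let I : Ideal (MvPolynomial (Fin n) ℂ) :=
    { carrier := {q | ∃ B : Matrix d e (MvPolynomial (Fin n) ℂ), B * M = q • 1}
      add_mem' := by
        rintro a b ⟨B, hB⟩ ⟨C, hC⟩
        exact ⟨B + C, by rw [Matrix.add_mul, hB, hC, add_smul]⟩
      zero_mem' := ⟨0, by simp⟩
      smul_mem' := by
        rintro c x ⟨B, hB⟩
        exact ⟨c • B, by rw [Matrix.smul_mul, hB, smul_smul, smul_eq_mul]⟩ }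
  have hI : ∀ ξ ∈ zeroLocus ℂ I, ξ = 0 := by
    intro ξ hξ
    by_contra hne
    have hinj := hM ξ hne
    obtain ⟨g, hg⟩ := (Matrix.mulVecLin (M.map (aeval ξ))).exists_leftInverse_of_injective
      (by rw [LinearMap.ker_eq_bot']; intro v hv; exact hinj v (by simpa using hv))
    set C : Matrix d e ℂ := LinearMap.toMatrix' g with hC
    have hCM : C * M.map (aeval ξ) = 1 := by
      have : Matrix.toLin' (C * M.map (aeval ξ)) = Matrix.toLin' 1 := by
        rw [Matrix.toLin'_mul, hC, Matrix.toLin'_toMatrix', Matrix.toLin'_one]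
        exact hg
      exact Matrix.toLin'.injective this
    set Q := (C.map (MvPolynomial.C (σ := Fin n))) * M with hQ
    have hq : Q.det ∈ I := ⟨Q.adjugate * C.map (MvPolynomial.C (σ := Fin n)), by
      rw [Matrix.mul_assoc, ← hQ, Matrix.adjugate_mul]⟩
    have h1 := (mem_zeroLocus_iff.1 hξ) _ hq
    rw [AlgHom.map_det] at h1
    have : (aeval ξ).mapMatrix Q = C * M.map (aeval ξ) := by
      ext i j
      simp [hQ, Matrix.mul_apply]
    rw [this, hCM, Matrix.det_one] at h1
    exact one_ne_zero h1
  have hX : ∀ i : Fin n, ∃ s : ℕ, (X i : MvPolynomial (Fin n) ℂ) ^ s ∈ I := by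
    intro i
    have : (X i : MvPolynomial (Fin n) ℂ) ∈ I.radical := by
      rw [← vanishingIdeal_zeroLocus_eq_radical (K := ℂ)]
      rw [mem_vanishingIdeal_iff]
      intro x hx
      rw [hI x hx]; simp
    exact this
  choose s hs using hX
  refine ⟨(∑ i, s i) + 1, fun β hβ => ?_⟩
  have : ∃ i, s i ≤ β i := by
    by_contra! h
    have : β.degree ≤ ∑ i, s i := by
      rw [Finsupp.degree_eq_sum]
      exact Finset.sum_le_sum fun i _ => (h i).le
    omega
  obtain ⟨i, hi⟩ := this
  have h2 : (monomial β (1:ℂ)) = monomial (β - Finsupp.single i (s i)) 1 * X i ^ (s i) := by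
    rw [X_pow_eq_monomial, monomial_mul, one_mul]
    congr 1
    rw [tsub_add_cancel_of_le]
    simpa using hi
  have : (monomial β (1:ℂ)) ∈ I := by
    rw [h2]; exact I.mul_mem_left _ (hs i)
  exact this

/-- The coordinate `k`-linear form `w ↦ ∏ j, (w j) (I j)`. -/
def ceE (n k : ℕ) (I : Fin k → Fin n) : ContinuousMultilinearMap ℝ (fun _ : Fin k => Euc n) ℝ :=
  (ContinuousMultilinearMap.mkPiAlgebra ℝ (Fin k) ℝ).compContinuousLinearMap
    (fun j => EuclideanSpace.proj (I j))

theorem ceE_apply (I : Fin k → Fin n) (w : Fin k → Euc n) :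
    ceE n k I w = ∏ j, w j (I j) := by
  simp [ceE]

/-- Standard basis vector. -/
def ceb (i : Fin n) : Euc n := EuclideanSpace.single i (1 : ℝ)

theorem ce_ext {X : Type*} [NormedAddCommGroup X] [NormedSpace ℝ X]
    {S T : ContinuousMultilinearMap ℝ (fun _ : Fin k => Euc n) X}
    (h : ∀ I : Fin k → Fin n, S (fun j => ceb (I j)) = T (fun j => ceb (I j))) : S = T := by
  apply ContinuousMultilinearMap.toMultilinearMap_injective
  refine Module.Basis.ext_multilinear (fun _ => (EuclideanSpace.basisFun (Fin n) ℝ).toBasis) ?_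
  intro I
  simpa [ceb] using h I

theorem ce_expand {X : Type*} [NormedAddCommGroup X] [NormedSpace ℝ X]
    (S : ContinuousMultilinearMap ℝ (fun _ : Fin k => Euc n) X) :
    S = ∑ I : Fin k → Fin n, (ceE n k I).smulRight (S (fun j => ceb (I j))) := by
  classical
  apply ce_ext
  intro K
  rw [_root_.sum_apply, Finset.sum_eq_single K]
  · simp [ceE_apply, ceb]
  · intro I _ hI
    obtain ⟨j, hj⟩ := Function.ne_iff.1 hI
    rw [ContinuousMultilinearMap.smulRight_apply, ceE_apply,
      Finset.prod_eq_zero (Finset.mem_univ j), zero_smul]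
    simp [ceb, hj]
  · simp

/-- multi-index of a tuple -/
def cea (I : Fin k → Fin n) : Fin n →₀ ℕ := ∑ j, Finsupp.single (I j) 1

theorem cea_degree (I : Fin k → Fin n) : (cea I).degree = k := by
  simp [cea]

open MvPolynomial in
/-- The polynomial matrix of the symbol. -/
def ceM (A : OpCoeff n k V W) : Matrix (Fin (Module.finrank ℝ W)) (Fin (Module.finrank ℝ V))
    (MvPolynomial (Fin n) ℂ) := fun w v => ∑ I : Fin k → Fin n,
      monomial (cea I) (((Module.finBasis ℝ W).repr
        (A ((ceE n k I).smulRight (Module.finBasis ℝ V v))) w : ℝ) : ℂ)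

theorem ce_repr (A : OpCoeff n k V W) (c : (Fin k → Fin n) → V) (w) :
    (Module.finBasis ℝ W).repr (A (∑ I, (ceE n k I).smulRight (c I))) w =
    ∑ I, ∑ v, (Module.finBasis ℝ V).repr (c I) v *
      (Module.finBasis ℝ W).repr (A ((ceE n k I).smulRight (Module.finBasis ℝ V v))) w := by
  rw [map_sum, map_sum, Finsupp.finsetSum_apply]
  refine Finset.sum_congr rfl fun I _ => ?_
  have : (ceE n k I).smulRight (c I) = ∑ v, (Module.finBasis ℝ V).repr (c I) v •
      (ceE n k I).smulRight (Module.finBasis ℝ V v) := by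
    ext x
    simp only [ContinuousMultilinearMap.smulRight_apply, _root_.sum_apply,
      _root_.smul_apply]
    conv_lhs => rw [← (Module.finBasis ℝ V).sum_repr (c I)]
    rw [Finset.smul_sum]
    exact Finset.sum_congr rfl fun v _ => smul_comm _ _ _
  rw [this]
  simp [map_sum]

open MvPolynomial in
theorem ceM_inj (A : OpCoeff n k V W) (hA : IsCElliptic A) (ξ : Fin n → ℂ) (hξ : ξ ≠ 0)
    (v : Fin (Module.finrank ℝ V) → ℂ) (hv : ((ceM A).map (aeval ξ)).mulVec v = 0) : v = 0 := by
  set η₁ : Euc n := WithLp.toLp 2 (fun i => (ξ i).re) with hη₁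
  set η₂ : Euc n := WithLp.toLp 2 (fun i => (ξ i).im) with hη₂
  set bV := Module.finBasis ℝ V with hbV
  set v₁ : V := bV.equivFun.symm (fun i => (v i).re) with hv₁
  set v₂ : V := bV.equivFun.symm (fun i => (v i).im) with hv₂
  have hne : (η₁, η₂) ≠ 0 := by
    intro h
    apply hξ
    have h1 : η₁ = 0 := congrArg Prod.fst h
    have h2 : η₂ = 0 := congrArg Prod.snd h
    ext i
    apply Complex.ext
    · simpa [hη₁] using congrArg (fun z : Euc n => z i) h1
    · simpa [hη₂] using congrArg (fun z : Euc n => z i) h2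
  have hk : ∀ I : Fin k → Fin n, cxKernel n k η₁ η₂ (fun j => ceb (I j)) = ∏ j, ξ (I j) := by
    intro I
    simp only [cxKernel, ceb, ContinuousMultilinearMap.compContinuousLinearMap_apply]
    simp only [ContinuousMultilinearMap.coe_restrictScalars, ContinuousMultilinearMap.mkPiRing_apply,
      smul_eq_mul, mul_one]
    refine Finset.prod_congr rfl fun j _ => ?_
    simp only [_root_.add_apply, ContinuousLinearMap.comp_apply,
      _root_.smul_apply, innerSL_apply_apply, smul_eq_mul, Complex.ofRealCLM_apply,
      EuclideanSpace.inner_single_right]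
    simp only [hη₁, hη₂, one_mul, conj_trivial]
    rw [mul_comm]; exact Complex.re_add_im _
  have hr1 : ∀ i, bV.repr v₁ i = (v i).re := fun i => by
    rw [hv₁, Module.Basis.equivFun_symm_apply, Module.Basis.repr_sum_self]
  have hr2 : ∀ i, bV.repr v₂ i = (v i).im := fun i => by
    rw [hv₂, Module.Basis.equivFun_symm_apply, Module.Basis.repr_sum_self]
  have hw : ∀ w, ∑ I : Fin k → Fin n, ∑ i, (∏ j, ξ (I j)) * v i *
      (((Module.finBasis ℝ W).repr (A ((ceE n k I).smulRight (bV i))) w : ℝ) : ℂ) = 0 := by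
    intro w
    have := congrFun hv w
    simp only [Matrix.mulVec, dotProduct, Matrix.map_apply, ceM, map_sum, aeval_monomial,
      Pi.zero_apply, Finset.sum_mul] at this
    rw [Finset.sum_comm] at this
    rw [← this]
    refine Finset.sum_congr rfl fun I _ => Finset.sum_congr rfl fun i _ => ?_
    have : (cea I).prod (fun i e => ξ i ^ e) = ∏ j, ξ (I j) := by
      rw [cea, ← Finsupp.prod_finsetSum_index]
      · simp
      · simp
      · intros; rw [pow_add]
    rw [this]
    rw [Algebra.algebraMap_self, RingHom.id_apply, hbV]
    ring
  have hRe : A (cxSymTensorRe n k η₁ η₂ v₁ v₂) = 0 := by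
    apply (Module.finBasis ℝ W).repr.injective
    ext w
    rw [ce_expand (cxSymTensorRe n k η₁ η₂ v₁ v₂), ce_repr]
    have := congrArg Complex.re (hw w)
    simp only [Complex.re_sum, Complex.zero_re] at this
    rw [map_zero, Finsupp.zero_apply, ← this]
    refine Finset.sum_congr rfl fun I _ => Finset.sum_congr rfl fun i _ => ?_
    have h3 : cxSymTensorRe n k η₁ η₂ v₁ v₂ (fun j => ceb (I j)) =
        (∏ j, ξ (I j)).re • v₁ - (∏ j, ξ (I j)).im • v₂ := by
      simp [cxSymTensorRe, hk]
    rw [h3]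
    simp only [map_sub, map_smul, Finsupp.sub_apply, Finsupp.smul_apply, ← hbV, hr1, hr2,
      Complex.mul_re, Complex.ofReal_re, Complex.ofReal_im, smul_eq_mul, Complex.mul_im]
    ring
  have hIm : A (cxSymTensorIm n k η₁ η₂ v₁ v₂) = 0 := by
    apply (Module.finBasis ℝ W).repr.injective
    ext w
    rw [ce_expand (cxSymTensorIm n k η₁ η₂ v₁ v₂), ce_repr]
    have := congrArg Complex.im (hw w)
    simp only [Complex.im_sum, Complex.zero_im] at this
    rw [map_zero, Finsupp.zero_apply, ← this]
    refine Finset.sum_congr rfl fun I _ => Finset.sum_congr rfl fun i _ => ?_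
    have h3 : cxSymTensorIm n k η₁ η₂ v₁ v₂ (fun j => ceb (I j)) =
        (∏ j, ξ (I j)).im • v₁ + (∏ j, ξ (I j)).re • v₂ := by
      simp [cxSymTensorIm, hk]
    rw [h3]
    simp only [map_add, map_smul, Finsupp.add_apply, Finsupp.smul_apply, ← hbV, hr1, hr2,
      Complex.mul_re, Complex.ofReal_re, Complex.ofReal_im, smul_eq_mul, Complex.mul_im]
    ring
  obtain ⟨h1, h2⟩ := hA η₁ η₂ v₁ v₂ hne hRe hIm
  ext i
  apply Complex.ext
  · rw [← hr1 i, h1]; simp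
  · rw [← hr2 i, h2]; simp

open MvPolynomial in
theorem ce_jets (A : OpCoeff n k V W) (hA : IsCElliptic A) :
    ∃ m0 : ℕ, ∀ m, m0 ≤ m → k ≤ m → ∀ c : (Fin n →₀ ℕ) → V,
      (∀ γ : Fin n →₀ ℕ, γ.degree + k = m →
        A (∑ I, (ceE n k I).smulRight (c (γ + cea I))) = 0) →
      ∀ β : Fin n →₀ ℕ, β.degree = m → c β = 0 := by
  classical
  obtain ⟨m0, hm0⟩ := ce_alg (ceM A) (ceM_inj A hA)
  refine ⟨m0, fun m hm hkm c hc β hβ => ?_⟩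
  set bV := Module.finBasis ℝ V with hbV
  set c' : Fin (Module.finrank ℝ V) → (MvPolynomial (Fin n) ℂ →ₗ[ℂ] ℂ) := fun v =>
    (basisMonomials (Fin n) ℂ).constr ℂ
      (fun β => if β.degree = m then ((bV.repr (c β) v : ℝ) : ℂ) else 0) with hc'
  have hc'1 : ∀ v β r, c' v (monomial β r) =
      r * (if β.degree = m then ((bV.repr (c β) v : ℝ) : ℂ) else 0) := by
    intro v β r
    have : (monomial β r : MvPolynomial (Fin n) ℂ) = r • (basisMonomials (Fin n) ℂ β) := by
      simp [coe_basisMonomials, smul_monomial]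
    rw [this, map_smul, hc', Module.Basis.constr_basis, smul_eq_mul]
  have key : ∀ w (b : MvPolynomial (Fin n) ℂ), ∑ v, c' v (b * ceM A w v) = 0 := by
    intro w b
    induction b using MvPolynomial.induction_on' with
    | add p q hp hq =>
      simp only [add_mul, map_add, Finset.sum_add_distrib, hp, hq, add_zero]
    | monomial γ r =>
      simp only [ceM, Finset.mul_sum, monomial_mul, map_sum, hc'1, map_add, cea_degree]
      split_ifs with h
      · have := hc γ h
        have h2 := congrArg (fun z => (((Module.finBasis ℝ W).repr z w : ℝ) : ℂ)) this
        simp only [ce_repr, map_zero, Finsupp.zero_apply, Complex.ofReal_zero,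
          Complex.ofReal_sum, Complex.ofReal_mul] at h2
        rw [Finset.sum_comm]
        rw [← mul_zero r, ← h2, Finset.mul_sum]
        refine Finset.sum_congr rfl fun I _ => ?_
        rw [Finset.mul_sum]
        refine Finset.sum_congr rfl fun i _ => ?_
        ring
      · simp
  obtain ⟨B, hB⟩ := hm0 β (by omega)
  apply bV.repr.injective
  ext v
  rw [map_zero, Finsupp.zero_apply]
  have h1 : ∑ v', c' v' ((B * ceM A) v v') = 0 := by
    simp only [Matrix.mul_apply, map_sum]
    rw [Finset.sum_comm]
    exact Finset.sum_eq_zero fun w _ => key w _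
  rw [hB, Finset.sum_eq_single v] at h1
  · simp only [Matrix.smul_apply, Matrix.one_apply_eq, smul_eq_mul, mul_one, hc'1, hβ, if_true,
      one_mul] at h1
    exact_mod_cast h1
  · intro v' _ hv'
    simp [Matrix.one_apply_ne hv'.symm]
  · simp


section jets
variable {X Y : Type*} [NormedAddCommGroup X] [NormedSpace ℝ X]
  [NormedAddCommGroup Y] [NormedSpace ℝ Y]

/-- Iterated partial derivatives along a list. -/
def cepd : List (Fin n) → (Euc n → X) → Euc n → X
  | [], f => f
  | i :: I, f => fun y => fderiv ℝ (cepd I f) y (ceb i)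

theorem cepd_smooth (I : List (Fin n)) {f : Euc n → X} (hf : ContDiff ℝ (⊤ : ℕ∞) f) :
    ContDiff ℝ (⊤ : ℕ∞) (cepd I f) := by
  induction I with
  | nil => exact hf
  | cons i I ih => exact (ih.fderiv_right (by simp)).clm_apply contDiff_const

theorem cepd_append (I J : List (Fin n)) (f : Euc n → X) :
    cepd (I ++ J) f = cepd I (cepd J f) := by
  induction I with
  | nil => rfl
  | cons i I ih => simp only [List.cons_append, cepd, ih]

theorem cepd_comp (I : List (Fin n)) (g : X →L[ℝ] Y) {f : Euc n → X}
    (hf : ContDiff ℝ (⊤ : ℕ∞) f) :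
    cepd I (fun y => g (f y)) = fun y => g (cepd I f y) := by
  induction I with
  | nil => rfl
  | cons i I ih =>
    funext y
    simp only [cepd, ih]
    have := (g.hasFDerivAt (x := cepd I f y)).comp y
      ((cepd_smooth I hf).differentiable (by simp) y).hasFDerivAt
    rw [show (fun y => g (cepd I f y)) = g ∘ cepd I f from rfl, this.fderiv]
    rfl

theorem cepd_perm {I J : List (Fin n)} (h : I.Perm J) {f : Euc n → X}
    (hf : ContDiff ℝ (⊤ : ℕ∞) f) : cepd I f = cepd J f := by
  induction h with
  | nil => rfl
  | cons i _ ih => simp only [cepd, ih]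
  | trans _ _ ih1 ih2 => exact ih1.trans ih2
  | swap i j I =>
    funext y
    simp only [cepd]
    have hg := cepd_smooth I hf
    set g := cepd I f
    have hd : DifferentiableAt ℝ (fderiv ℝ g) y :=
      (hg.fderiv_right (m := (⊤ : ℕ∞)) (by simp)).differentiable (by simp) y
    have h1 : ∀ a b : Euc n, fderiv ℝ (fun y => fderiv ℝ g y a) y b =
        fderiv ℝ (fderiv ℝ g) y b a := by
      intro a b
      rw [fderiv_clm_apply hd (differentiableAt_const a)]
      simp
    rw [h1, h1]
    exact (hg.contDiffAt.isSymmSndFDerivAt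
      (by
        simp only [minSmoothness_of_isRCLikeNormedField]
        have h2 : ∀ j : ℕ, (j : WithTop ℕ∞) ≤ ((⊤ : ℕ∞) : WithTop ℕ∞) := fun j => by
          exact_mod_cast le_top
        exact h2 2)) _ _

theorem ce_iter_eq (j : ℕ) (I : Fin j → Fin n) {f : Euc n → X}
    (hf : ContDiff ℝ (⊤ : ℕ∞) f) (x : Euc n) :
    iteratedFDeriv ℝ j f x (fun i => ceb (I i)) = cepd (List.ofFn I) f x := by
  induction j generalizing x with
  | zero => simp [cepd]
  | succ j ih =>
    rw [iteratedFDeriv_succ_apply_left, List.ofFn_succ]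
    simp only [cepd]
    have hd : DifferentiableAt ℝ (iteratedFDeriv ℝ j f) x :=
      hf.differentiable_iteratedFDeriv (by exact_mod_cast WithTop.coe_lt_top j) x
    have : cepd (List.ofFn fun i => I i.succ) f = fun y => iteratedFDeriv ℝ j f y
        (fun i => ceb (I i.succ)) := by
      funext y; exact (ih (fun i => I i.succ) y).symm
    rw [this]
    have h2 := ((ContinuousMultilinearMap.apply ℝ (fun _ : Fin j => Euc n) X
      (fun i => ceb (I i.succ))).hasFDerivAt (x := iteratedFDeriv ℝ j f x)).comp x hd.hasFDerivAt
    have h3 := congrArg (fun T => T (ceb (I 0))) h2.fderiv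
    exact h3.symm

theorem ce_iter_smooth (j : ℕ) {f : Euc n → X} (hf : ContDiff ℝ (⊤ : ℕ∞) f) :
    ContDiff ℝ (⊤ : ℕ∞) (iteratedFDeriv ℝ j f) := by
  refine hf.iteratedFDeriv_right ?_
  exact_mod_cast le_top

theorem ce_iter_iter (j l : ℕ) (J : Fin j → Fin n) (I : Fin l → Fin n) {f : Euc n → X}
    (hf : ContDiff ℝ (⊤ : ℕ∞) f) (x : Euc n) :
    iteratedFDeriv ℝ j (iteratedFDeriv ℝ l f) x (fun i => ceb (J i)) (fun i => ceb (I i)) =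
      cepd (List.ofFn J ++ List.ofFn I) f x := by
  rw [ce_iter_eq j J (ce_iter_smooth l hf)]
  have := congrFun (cepd_comp (List.ofFn J) (ContinuousMultilinearMap.apply ℝ
    (fun _ : Fin l => Euc n) X (fun i => ceb (I i))) (ce_iter_smooth l hf)) x
  rw [cepd_append]
  have h2 : cepd (List.ofFn I) f = fun y => iteratedFDeriv ℝ l f y (fun i => ceb (I i)) := by
    funext y; exact (ce_iter_eq l I hf y).symm
  rw [h2]
  exact this.symm

/-- multi-index derivative at zero -/
def cejet (f : Euc n → X) (x : Euc n) (β : Fin n →₀ ℕ) : X :=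
  cepd (Finsupp.toMultiset β).toList f x

theorem cejet_list (L : List (Fin n)) {f : Euc n → X} (hf : ContDiff ℝ (⊤ : ℕ∞) f) (x : Euc n) :
    cejet f x (Multiset.toFinsupp (L : Multiset (Fin n))) = cepd L f x := by
  unfold cejet
  rw [Multiset.toFinsupp_toMultiset]
  refine congrFun (cepd_perm ?_ hf) x
  rw [← Multiset.coe_eq_coe, Multiset.coe_toList]

theorem cea_ofFn (I : Fin k → Fin n) :
    cea I = Multiset.toFinsupp ((List.ofFn I : List (Fin n)) : Multiset (Fin n)) := by
  induction k with
  | zero => simp [cea]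
  | succ k ih =>
    have := ih (fun i => I i.succ)
    rw [cea, Fin.sum_univ_succ, List.ofFn_succ, ← Multiset.cons_coe, ← Multiset.singleton_add,
      map_add, ← this, Multiset.toFinsupp_singleton, cea]

end jets

theorem ce_opApply_eq (A : OpCoeff n k V W) (u : Euc n → V) :
    opApply A u = fun x => A (iteratedFDeriv ℝ k u x) := rfl

theorem ce_kernel (A : OpCoeff n k V W) (hA : IsCElliptic A) :
    ∃ m0 : ℕ, ∀ m, m0 ≤ m → k ≤ m → ∀ u : Euc n → V, ContDiff ℝ (⊤ : ℕ∞) u → ∀ x,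
      iteratedFDeriv ℝ (m - k) (opApply A u) x = 0 → ∀ N l, N + l = m →
      iteratedFDeriv ℝ N (iteratedFDeriv ℝ l u) x = 0 := by
  obtain ⟨m0, hm0⟩ := ce_jets A hA
  refine ⟨m0, fun m hm hkm u hu x hx N l hNl => ?_⟩
  have key := hm0 m hm hkm (cejet u x) ?_
  · apply ce_ext
    intro J
    apply ce_ext
    intro I
    rw [ce_iter_iter N l J I hu x, ← cejet_list _ hu]
    rw [key]
    · simp
    · rw [← Multiset.coe_add, map_add, ← cea_ofFn, ← cea_ofFn, map_add, cea_degree, cea_degree, hNl]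
  · intro γ hγ
    set L := (Finsupp.toMultiset γ).toList with hL
    have hlen : L.length = m - k := by
      rw [hL, Multiset.length_toList, Finsupp.card_toMultiset]
      rw [Finsupp.degree_eq_sum] at hγ
      rw [Finsupp.sum_fintype _ _ (by simp)]
      simp only [id]
      omega
    have hγL : γ = Multiset.toFinsupp (L : Multiset (Fin n)) := by
      rw [hL, Multiset.coe_toList, Finsupp.toMultiset_toFinsupp]
    obtain ⟨J, hJ⟩ : ∃ J : Fin (m - k) → Fin n, List.ofFn J = L := by
      rw [← hlen]
      exact ⟨L.get, List.ofFn_get L⟩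
    have h1 := congrArg (fun T => T (fun i => ceb (J i))) hx
    simp only [_root_.zero_apply] at h1
    have hs := ce_iter_smooth k hu
    rw [ce_iter_eq _ J (by rw [ce_opApply_eq]; exact A.contDiff.comp hs), ce_opApply_eq,
      cepd_comp _ A hs] at h1
    beta_reduce at h1
    rw [ce_expand (cepd (List.ofFn J) (iteratedFDeriv ℝ k u) x)] at h1
    rw [← h1]
    congr 1
    refine Finset.sum_congr rfl fun I _ => ?_
    congr 1
    rw [← ce_iter_eq _ J hs, ce_iter_iter _ _ J I hu, hγL, cea_ofFn, ← map_add, hJ,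
      Multiset.coe_add, cejet_list _ hu]

instance ce_cmm_fin (j : ℕ) {X : Type*} [NormedAddCommGroup X] [NormedSpace ℝ X]
    [FiniteDimensional ℝ X] :
    FiniteDimensional ℝ (ContinuousMultilinearMap ℝ (fun _ : Fin j => Euc n) X) := by
  let φ : ContinuousMultilinearMap ℝ (fun _ : Fin j => Euc n) X →ₗ[ℝ]
      MultilinearMap ℝ (fun _ : Fin j => Euc n) X :=
    { toFun := fun f => f.toMultilinearMap, map_add' := fun _ _ => rfl, map_smul' := fun _ _ => rfl }
  exact Module.Finite.of_injective φ ContinuousMultilinearMap.toMultilinearMap_injective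

theorem ce_factor {U X Y : Type*} [AddCommGroup U] [Module ℝ U] [AddCommGroup X] [Module ℝ X]
    [AddCommGroup Y] [Module ℝ Y] (a : U →ₗ[ℝ] X) (b : U →ₗ[ℝ] Y)
    (h : ∀ u, a u = 0 → b u = 0) : ∃ L : X →ₗ[ℝ] Y, ∀ u, b u = L (a u) := by
  have hle : LinearMap.ker a ≤ LinearMap.ker b := fun u hu => h u hu
  obtain ⟨L, hL⟩ := LinearMap.exists_extend
    (((LinearMap.ker a).liftQ b hle).comp a.quotKerEquivRange.symm.toLinearMap)
  refine ⟨L, fun u => ?_⟩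
  have := congrArg (fun T => T ⟨a u, LinearMap.mem_range_self a u⟩) hL
  simp only [LinearMap.comp_apply, Submodule.subtype_apply, LinearEquiv.coe_coe,
    LinearMap.quotKerEquivRange_symm_apply_image] at this
  rw [this]
  simp

/-- `D^N D^l u = L (D^{m-k} 𝔸 u)`. -/
theorem ce_repr_deriv (A : OpCoeff n k V W) (hA : IsCElliptic A) :
    ∃ m0 : ℕ, ∀ m, m0 ≤ m → k ≤ m → ∀ N l, N + l = m →
      ∃ L : ContinuousMultilinearMap ℝ (fun _ : Fin (m - k) => Euc n) W →L[ℝ]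
        ContinuousMultilinearMap ℝ (fun _ : Fin N => Euc n)
          (ContinuousMultilinearMap ℝ (fun _ : Fin l => Euc n) V),
      ∀ u : Euc n → V, ContDiff ℝ (⊤ : ℕ∞) u → ∀ x,
        iteratedFDeriv ℝ N (iteratedFDeriv ℝ l u) x =
          L (iteratedFDeriv ℝ (m - k) (opApply A u) x) := by
  obtain ⟨m0, hm0⟩ := ce_kernel A hA
  refine ⟨m0, fun m hm hkm N l hNl => ?_⟩
  let U : Submodule ℝ (Euc n → V) :=
    { carrier := {u | ContDiff ℝ (⊤ : ℕ∞) u}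
      add_mem' := by
        intro a b ha hb
        simp only [Set.mem_ofPred_eq] at *
        exact ha.add hb
      zero_mem' := by
        simp only [Set.mem_ofPred_eq]
        exact contDiff_const
      smul_mem' := by
        intro c u hu
        simp only [Set.mem_ofPred_eq] at *
        exact hu.const_smul c }
  have hle : ∀ j : ℕ, (j : WithTop ℕ∞) ≤ ((⊤ : ℕ∞) : WithTop ℕ∞) := fun j => by
    exact_mod_cast le_top
  have hop : ∀ u : Euc n → V, ContDiff ℝ (⊤ : ℕ∞) u → ContDiff ℝ (⊤ : ℕ∞) (opApply A u) :=
    fun u hu => by rw [ce_opApply_eq]; exact A.contDiff.comp (ce_iter_smooth k hu)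
  have hadd : ∀ (j : ℕ) (u v : Euc n → V), ContDiff ℝ (⊤ : ℕ∞) u → ContDiff ℝ (⊤ : ℕ∞) v →
      iteratedFDeriv ℝ j (u + v) = iteratedFDeriv ℝ j u + iteratedFDeriv ℝ j v :=
    fun j u v hu hv => iteratedFDeriv_add (hu.of_le (hle j)) (hv.of_le (hle j))
  have hsm : ∀ (j : ℕ) (c : ℝ) (u : Euc n → V), ContDiff ℝ (⊤ : ℕ∞) u →
      iteratedFDeriv ℝ j (c • u) = c • iteratedFDeriv ℝ j u :=
    fun j c u hu => funext fun x => iteratedFDeriv_const_smul_apply (hu.of_le (hle j)).contDiffAt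
  let b : U →ₗ[ℝ] ContinuousMultilinearMap ℝ (fun _ : Fin N => Euc n)
          (ContinuousMultilinearMap ℝ (fun _ : Fin l => Euc n) V) :=
    { toFun := fun u => iteratedFDeriv ℝ N (iteratedFDeriv ℝ l u.1) 0
      map_add' := by
        rintro ⟨u, hu⟩ ⟨v, hv⟩
        simp only [AddMemClass.mk_add_mk]
        rw [hadd l u v hu hv, iteratedFDeriv_add ((ce_iter_smooth l hu).of_le (hle _))
          ((ce_iter_smooth l hv).of_le (hle _)), Pi.add_apply]
      map_smul' := by
        rintro c ⟨u, hu⟩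
        simp only [SetLike.mk_smul_mk, RingHom.id_apply]
        rw [hsm l c u hu, iteratedFDeriv_const_smul_apply
          ((ce_iter_smooth l hu).of_le (hle _)).contDiffAt] }
  let a : U →ₗ[ℝ] ContinuousMultilinearMap ℝ (fun _ : Fin (m - k) => Euc n) W :=
    { toFun := fun u => iteratedFDeriv ℝ (m - k) (opApply A u.1) 0
      map_add' := by
        rintro ⟨u, hu⟩ ⟨v, hv⟩
        simp only [AddMemClass.mk_add_mk]
        have : opApply A (u + v) = opApply A u + opApply A v := by
          funext x; simp [opApply, hadd k u v hu hv]
        rw [this, iteratedFDeriv_add ((hop u hu).of_le (hle _))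
          ((hop v hv).of_le (hle _)), Pi.add_apply]
      map_smul' := by
        rintro c ⟨u, hu⟩
        simp only [SetLike.mk_smul_mk, RingHom.id_apply]
        have : opApply A (c • u) = c • opApply A u := by
          funext x; simp [opApply, hsm k c u hu]
        rw [this, iteratedFDeriv_const_smul_apply ((hop u hu).of_le (hle _)).contDiffAt] }
  obtain ⟨L, hL⟩ := ce_factor a b (fun u hu => hm0 m hm hkm u.1 u.2 0 hu N l hNl)
  refine ⟨LinearMap.toContinuousLinearMap L, fun u hu x => ?_⟩
  have hu' : ContDiff ℝ (⊤ : ℕ∞) (fun z => u (x + z)) := hu.comp (contDiff_const.add contDiff_id)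
  have := hL ⟨fun z => u (x + z), hu'⟩
  have e1 : ∀ j, iteratedFDeriv ℝ j (fun z => u (x + z)) = fun z => iteratedFDeriv ℝ j u (x + z) :=
    fun j => funext fun z => iteratedFDeriv_comp_add_left j x z
  have e2 : opApply A (fun z => u (x + z)) = fun z => opApply A u (x + z) := by
    funext z; simp only [opApply, e1]
  simp only [a, b, LinearMap.coe_mk, AddHom.coe_mk, e1, e2, iteratedFDeriv_comp_add_left,
    add_zero] at this
  exact this


section weights
variable {X Y Z : Type*} [NormedAddCommGroup X] [NormedSpace ℝ X]
  [NormedAddCommGroup Y] [NormedSpace ℝ Y] [NormedAddCommGroup Z] [NormedSpace ℝ Z]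

/-- Smooth operator-valued weights, supported in `‖z‖ ≤ 1/2`. -/
def ceWt (G : Euc n × Euc n → (X →L[ℝ] Y)) : Prop :=
  ContDiff ℝ (⊤ : ℕ∞) G ∧ ∀ x z, 1 / 2 < ‖z‖ → G (x, z) = 0

/-- the path point -/
def cey (x z : Euc n) (t : ℝ) : Euc n := x + t • (z - x)

theorem ceWt.hcs {G : Euc n × Euc n → (X →L[ℝ] Y)} (hG : ceWt G) (x : Euc n) (f : Euc n → X) :
    HasCompactSupport (fun z => G (x, z) (f z)) := by
  refine HasCompactSupport.intro (isCompact_closedBall (0 : Euc n) (1 / 2)) fun z hz => ?_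
  rw [hG.2 x z (by simpa using hz), _root_.zero_apply]

theorem ceWt.integrable {G : Euc n × Euc n → (X →L[ℝ] Y)} (hG : ceWt G) (x : Euc n)
    {f : Euc n → X} (hf : Continuous f) : Integrable (fun z => G (x, z) (f z)) := by
  refine Continuous.integrable_of_hasCompactSupport ?_ (hG.hcs x f)
  exact (hG.1.continuous.comp (by fun_prop)).clm_apply hf

theorem ceWt.comp {G : Euc n × Euc n → (X →L[ℝ] Y)} (hG : ceWt G) (L : Z →L[ℝ] X) :
    ceWt (fun q => (G q).comp L) := by
  refine ⟨hG.1.clm_comp contDiff_const, fun x z hz => ?_⟩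
  simp only [hG.2 x z hz, ContinuousLinearMap.zero_comp]

theorem ceWt.add {G G' : Euc n × Euc n → (X →L[ℝ] Y)} (hG : ceWt G) (hG' : ceWt G') :
    ceWt (fun q => G q + G' q) :=
  ⟨hG.1.add hG'.1, fun x z hz => by simp only [hG.2 x z hz, hG'.2 x z hz, add_zero]⟩

theorem ceWt.smul {G : Euc n × Euc n → (X →L[ℝ] Y)} (hG : ceWt G) (c : ℝ) :
    ceWt (fun q => c • G q) :=
  ⟨hG.1.const_smul c, fun x z hz => by simp only [hG.2 x z hz, smul_zero]⟩

theorem ceWt.sum {ι : Type*} (s : Finset ι) {G : ι → Euc n × Euc n → (X →L[ℝ] Y)}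
    (hG : ∀ i, ceWt (G i)) : ceWt (fun q => ∑ i ∈ s, G i q) :=
  ⟨ContDiff.sum fun i _ => (hG i).1, fun x z hz => Finset.sum_eq_zero fun i _ => (hG i).2 x z hz⟩

theorem ceWt.deriv {G : Euc n × Euc n → (X →L[ℝ] Y)} (hG : ceWt G) (e : Euc n) :
    ceWt (fun q => fderiv ℝ G q (0, e)) := by
  refine ⟨(hG.1.fderiv_right (by simp)).clm_apply contDiff_const, fun x z hz => ?_⟩
  have : G =ᶠ[nhds (x, z)] fun _ => 0 := by
    have ho : IsOpen {q : Euc n × Euc n | 1 / 2 < ‖q.2‖} :=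
      isOpen_lt continuous_const (by fun_prop)
    filter_upwards [ho.mem_nhds hz] with q hq
    exact hG.2 q.1 q.2 hq
  show fderiv ℝ G (x, z) (0, e) = 0
  rw [this.fderiv_eq]
  simp

/-- contraction with `z - x` -/
def ceplus (G : Euc n × Euc n → (X →L[ℝ] Y)) (q : Euc n × Euc n) : (Euc n →L[ℝ] X) →L[ℝ] Y :=
  (G q).comp (ContinuousLinearMap.apply ℝ X (q.2 - q.1))

theorem ceplus_wt {G : Euc n × Euc n → (X →L[ℝ] Y)} (hG : ceWt G) : ceWt (ceplus G) := by
  refine ⟨hG.1.clm_comp ?_, fun x z hz => ?_⟩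
  · exact (ContinuousLinearMap.contDiff (𝕜 := ℝ) (E := Euc n) (F := (Euc n →L[ℝ] X) →L[ℝ] X)
      (ContinuousLinearMap.apply ℝ X)).comp (contDiff_snd.sub contDiff_fst)
  · simp only [ceplus, hG.2 x z hz, ContinuousLinearMap.zero_comp]

theorem ce_hasDeriv {G : Euc n × Euc n → (X →L[ℝ] Y)} (hG : ceWt G) {f : Euc n → X}
    (hf : ContDiff ℝ (⊤ : ℕ∞) f) (x : Euc n) (t : ℝ) :
    HasDerivAt (fun t => ∫ z, G (x, z) (f (cey x z t)))
      (∫ z, ceplus G (x, z) (fderiv ℝ f (cey x z t))) t := by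
  have hf' : Continuous (fderiv ℝ f) := hf.continuous_fderiv (by simp)
  have hyc : Continuous (fun q : ℝ × Euc n => cey x q.2 q.1) := by unfold cey; fun_prop
  have hcont : Continuous (fun q : ℝ × Euc n => ceplus G (x, q.2) (fderiv ℝ f (cey x q.2 q.1))) :=
    ((ceplus_wt hG).1.continuous.comp (by fun_prop)).clm_apply (hf'.comp hyc)
  obtain ⟨C, hC⟩ := ((isCompact_closedBall t 1).prod
    (isCompact_closedBall (0 : Euc n) (1 / 2))).exists_bound_of_continuousOn hcont.continuousOn
  have hIg : ∀ s, Integrable (fun z => G (x, z) (f (cey x z s))) := fun s =>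
    hG.integrable x (hf.continuous.comp (by unfold cey; fun_prop))
  have hIg' : ∀ s, Integrable (fun z => ceplus G (x, z) (fderiv ℝ f (cey x z s))) := fun s =>
    (ceplus_wt hG).integrable x (hf'.comp (by unfold cey; fun_prop))
  refine (hasDerivAt_integral_of_dominated_loc_of_deriv_le (μ := volume)
    (F := fun t z => G (x, z) (f (cey x z t)))
    (F' := fun t z => ceplus G (x, z) (fderiv ℝ f (cey x z t)))
    (bound := (closedBall (0 : Euc n) (1 / 2)).indicator (fun _ => C)) (closedBall_mem_nhds t one_pos)
    (Filter.Eventually.of_forall fun s => (hIg s).aestronglyMeasurable) (hIg t)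
    (hIg' t).aestronglyMeasurable ?_ ?_ ?_).2
  · refine Filter.Eventually.of_forall fun z s hs => ?_
    by_cases hz : z ∈ closedBall (0 : Euc n) (1 / 2)
    · rw [Set.indicator_of_mem hz]
      exact hC (s, z) ⟨hs, hz⟩
    · rw [Set.indicator_of_notMem hz, (ceplus_wt hG).2 x z (by simpa using hz)]
      simp
  · rw [integrable_indicator_iff measurableSet_closedBall]
    exact integrableOn_const (measure_closedBall_lt_top.ne)
  · refine Filter.Eventually.of_forall fun z s _ => ?_
    have h1 : HasDerivAt (fun s => cey x z s) (z - x) s := by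
      unfold cey
      simpa using ((hasDerivAt_id s).smul_const (z - x)).const_add x
    have h2 : HasDerivAt (fun s => f (cey x z s)) (fderiv ℝ f (cey x z s) (z - x)) s :=
      ((hf.differentiable (by simp) (cey x z s)).hasFDerivAt).comp_hasDerivAt s h1
    exact ((G (x, z)).hasFDerivAt).comp_hasDerivAt s h2

theorem ce_ibp {G : Euc n × Euc n → ((Euc n →L[ℝ] X) →L[ℝ] Y)} (hG : ceWt G) :
    ∃ G' : Euc n × Euc n → (X →L[ℝ] Y), ceWt G' ∧ ∀ f : Euc n → X, ContDiff ℝ (⊤ : ℕ∞) f →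
      ∀ x t, t • ∫ z, G (x, z) (fderiv ℝ f (cey x z t)) = ∫ z, G' (x, z) (f (cey x z t)) := by
  let P : Fin n → (X →L[ℝ] (Euc n →L[ℝ] X)) := fun i =>
    (ContinuousLinearMap.smulRightL ℝ (Euc n) X (EuclideanSpace.proj i))
  have hP : ∀ i a w, P i a w = w i • a := fun i a w => rfl
  let Gi : Fin n → Euc n × Euc n → (X →L[ℝ] Y) := fun i q => (G q).comp (P i)
  have hGi : ∀ i, ceWt (Gi i) := fun i => hG.comp (P i)
  have hsum : ∀ (T : Euc n →L[ℝ] X), T = ∑ i, P i (T (ceb i)) := by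
    intro T
    ext w
    rw [_root_.sum_apply]
    simp only [hP, ← map_smul, ← map_sum]
    congr 1
    ext j
    simp [ceb, Finset.sum_apply, Pi.single_apply]
  refine ⟨fun q => (-1 : ℝ) • ∑ i, fderiv ℝ (Gi i) q (0, ceb i),
    (ceWt.sum _ fun i => (hGi i).deriv _).smul (-1), fun f hf x t => ?_⟩
  have hyd : ∀ z, HasFDerivAt (fun z => cey x z t) (t • ContinuousLinearMap.id ℝ (Euc n)) z := by
    intro z
    unfold cey
    exact (((hasFDerivAt_id z).sub_const x).const_smul t).const_add x
  have hys : ContDiff ℝ (⊤ : ℕ∞) (fun z => cey x z t) := by unfold cey; fun_prop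
  have hfs : ContDiff ℝ (⊤ : ℕ∞) (fun z => f (cey x z t)) := hf.comp hys
  have hfd : ∀ z, HasFDerivAt (fun z => f (cey x z t))
      ((fderiv ℝ f (cey x z t)).comp (t • ContinuousLinearMap.id ℝ (Euc n))) z := fun z =>
    ((hf.differentiable (by simp) (cey x z t)).hasFDerivAt).comp z (hyd z)
  have hgd : ∀ i z, HasFDerivAt (fun z => Gi i (x, z))
      ((fderiv ℝ (Gi i) (x, z)).comp (ContinuousLinearMap.inr ℝ (Euc n) (Euc n))) z := fun i z =>
    (((hGi i).1.differentiable (by simp) (x, z)).hasFDerivAt).comp z (hasFDerivAt_prodMk_right x z)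
  have hf' : Continuous (fderiv ℝ f) := hf.continuous_fderiv (by simp)
  have hfdc : ∀ i, Continuous (fun z => t • (fderiv ℝ f (cey x z t) (ceb i))) := fun i =>
    ((hf'.comp hys.continuous).clm_apply continuous_const).const_smul t
  have hib : ∀ i, ∫ z, Gi i (x, z) (t • (fderiv ℝ f (cey x z t) (ceb i))) =
      - ∫ z, fderiv ℝ (Gi i) (x, z) (0, ceb i) (f (cey x z t)) := by
    intro i
    have := integral_bilinear_hasFDerivAt_right_eq_neg_left_of_integrable (μ := volume) (v := ceb i)
      (B := ContinuousLinearMap.id ℝ (X →L[ℝ] Y))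
      (f := fun z => Gi i (x, z)) (g := fun z => f (cey x z t))
      (f' := fun z => (fderiv ℝ (Gi i) (x, z)).comp (ContinuousLinearMap.inr ℝ (Euc n) (Euc n)))
      (g' := fun z => (fderiv ℝ f (cey x z t)).comp (t • ContinuousLinearMap.id ℝ (Euc n)))
      (by
        simpa using ((hGi i).deriv (ceb i)).integrable x hfs.continuous)
      (by
        simpa using (hGi i).integrable x (hfdc i))
      (by simpa using (hGi i).integrable x hfs.continuous)
      (fun z _ => hgd i z) (fun z _ => hfd z)
    simpa using this
  have e1 : ∀ z, t • G (x, z) (fderiv ℝ f (cey x z t)) =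
      ∑ i, Gi i (x, z) (t • (fderiv ℝ f (cey x z t) (ceb i))) := by
    intro z
    conv_lhs => rw [hsum (fderiv ℝ f (cey x z t))]
    rw [map_sum, Finset.smul_sum]
    refine Finset.sum_congr rfl fun i _ => ?_
    simp only [Gi, ContinuousLinearMap.comp_apply, map_smul]
  rw [← integral_smul]
  simp only [e1]
  rw [integral_finsetSum _ fun i _ => (hGi i).integrable x (hfdc i)]
  simp only [hib, neg_smul, one_smul, _root_.neg_apply, _root_.sum_apply]
  rw [integral_neg, integral_finsetSum _ fun i _ =>
    ((hGi i).deriv (ceb i)).integrable x hfs.continuous, Finset.sum_neg_distrib]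

theorem ce_ibp_iter (j : ℕ) {G : Euc n × Euc n →
      ((ContinuousMultilinearMap ℝ (fun _ : Fin j => Euc n) X) →L[ℝ] Y)} (hG : ceWt G) :
    ∃ G' : Euc n × Euc n → (X →L[ℝ] Y), ceWt G' ∧ ∀ f : Euc n → X, ContDiff ℝ (⊤ : ℕ∞) f →
      ∀ x t, t ^ j • ∫ z, G (x, z) (iteratedFDeriv ℝ j f (cey x z t)) =
        ∫ z, G' (x, z) (f (cey x z t)) := by
  induction j with
  | zero =>
    refine ⟨_, hG.comp ((continuousMultilinearCurryFin0 ℝ (Euc n) X).symm.toContinuousLinearEquiv :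
      X →L[ℝ] _), fun f hf x t => ?_⟩
    simp only [pow_zero, one_smul]
    rfl
  | succ j ih =>
    obtain ⟨G1, hG1, h1⟩ := ce_ibp (hG.comp
      ((continuousMultilinearCurryLeftEquiv ℝ (fun _ : Fin (j + 1) => Euc n) X).symm.toContinuousLinearEquiv :
        (Euc n →L[ℝ] (ContinuousMultilinearMap ℝ (fun _ : Fin j => Euc n) X)) →L[ℝ] _))
    obtain ⟨G2, hG2, h2⟩ := ih hG1
    refine ⟨G2, hG2, fun f hf x t => ?_⟩
    rw [← h2 f hf x t, ← h1 _ (ce_iter_smooth j hf) x t, smul_smul, ← pow_succ]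
    rfl

theorem cey_one (x z : Euc n) : cey x z 1 = z := by simp [cey]
theorem cey_zero (x z : Euc n) : cey x z 0 = x := by simp [cey]

/-- Next Taylor weight. -/
def cenext (N : ℕ) (G : Euc n × Euc n →
      ((ContinuousMultilinearMap ℝ (fun _ : Fin N => Euc n) X) →L[ℝ] Y)) (q : Euc n × Euc n) :
    (ContinuousMultilinearMap ℝ (fun _ : Fin (N + 1) => Euc n) X) →L[ℝ] Y :=
  (ceplus G q).comp
    ((continuousMultilinearCurryLeftEquiv ℝ (fun _ : Fin (N + 1) => Euc n)
      X).toContinuousLinearEquiv :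
      (ContinuousMultilinearMap ℝ (fun _ : Fin (N + 1) => Euc n) X) →L[ℝ]
        (Euc n →L[ℝ] (ContinuousMultilinearMap ℝ (fun _ : Fin N => Euc n) X)))

theorem cenext_wt (N : ℕ) {G : Euc n × Euc n →
      ((ContinuousMultilinearMap ℝ (fun _ : Fin N => Euc n) X) →L[ℝ] Y)} (hG : ceWt G) :
    ceWt (cenext N G) := (ceplus_wt hG).comp _

theorem ce_step (N : ℕ) {G : Euc n × Euc n →
      ((ContinuousMultilinearMap ℝ (fun _ : Fin N => Euc n) X) →L[ℝ] Y)} (hG : ceWt G)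
    {f : Euc n → X} (hf : ContDiff ℝ (⊤ : ℕ∞) f) (x : Euc n) (t : ℝ) :
    HasDerivAt (fun t => ∫ z, G (x, z) (iteratedFDeriv ℝ N f (cey x z t)))
      (∫ z, cenext N G (x, z) (iteratedFDeriv ℝ (N + 1) f (cey x z t))) t := by
  have h := ce_hasDeriv hG (ce_iter_smooth N hf) x t
  have e : ∀ y, (continuousMultilinearCurryLeftEquiv ℝ (fun _ : Fin (N + 1) => Euc n) X)
      (iteratedFDeriv ℝ (N + 1) f y) = fderiv ℝ (iteratedFDeriv ℝ N f) y := by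
    intro y
    rw [iteratedFDeriv_succ_eq_comp_left, Function.comp_apply]
    exact LinearIsometryEquiv.apply_symm_apply _ _
  have e2 : ∀ z, cenext N G (x, z) (iteratedFDeriv ℝ (N + 1) f (cey x z t)) =
      ceplus G (x, z) (fderiv ℝ (iteratedFDeriv ℝ N f) (cey x z t)) := by
    intro z
    rw [← e]; rfl
  simp only [e2]
  exact h

theorem ce_cont (N : ℕ) {G : Euc n × Euc n →
      ((ContinuousMultilinearMap ℝ (fun _ : Fin N => Euc n) X) →L[ℝ] Y)} (hG : ceWt G)
    {f : Euc n → X} (hf : ContDiff ℝ (⊤ : ℕ∞) f) (x : Euc n) :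
    Continuous (fun t => ∫ z, G (x, z) (iteratedFDeriv ℝ N f (cey x z t))) :=
  continuous_iff_continuousAt.2 fun t => (ce_step N hG hf x t).continuousAt

theorem ce_taylor [CompleteSpace X] (N : ℕ) :
    ∃ (G0 : Euc n × Euc n → (X →L[ℝ] X)) (G1 : Euc n × Euc n →
      ((ContinuousMultilinearMap ℝ (fun _ : Fin (N + 1) => Euc n) X) →L[ℝ] X)),
      ceWt G0 ∧ ceWt G1 ∧ ∀ f : Euc n → X, ContDiff ℝ (⊤ : ℕ∞) f → ∀ x,
        f x = (∫ z, G0 (x, z) (f z)) +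
          ∫ t in (0 : ℝ)..1, t ^ N • ∫ z, G1 (x, z) (iteratedFDeriv ℝ (N + 1) f (cey x z t)) := by
  induction N with
  | zero =>
    let φ : ContDiffBump (0 : Euc n) := ⟨1 / 4, 1 / 2, by norm_num, by norm_num⟩
    let ω : Euc n → ℝ := φ.normed volume
    have hω : ceWt (fun q : Euc n × Euc n => ω q.2 • ContinuousLinearMap.id ℝ X) := by
      refine ⟨(φ.contDiff_normed.comp contDiff_snd).smul contDiff_const, fun x z hz => ?_⟩
      have : ω z = 0 := by
        have : z ∉ Function.support ω := by
          rw [φ.support_normed_eq]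
          simp only [mem_ball, dist_zero_right, not_lt]
          exact hz.le
        simpa using this
      simp [this]
    have hω0 := hω.comp ((continuousMultilinearCurryFin0 ℝ (Euc n) X).toContinuousLinearEquiv :
      (ContinuousMultilinearMap ℝ (fun _ : Fin 0 => Euc n) X) →L[ℝ] X)
    refine ⟨_, _, hω, (cenext_wt 0 hω0).smul (-1), fun f hf x => ?_⟩
    have hh := fun t => ce_step 0 hω0 hf x t
    have hc := ce_cont (0 + 1) (cenext_wt 0 hω0) hf x
    have hftc := intervalIntegral.integral_eq_sub_of_hasDerivAt (a := 0) (b := 1)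
      (fun t _ => hh t) (hc.intervalIntegrable _ _)
    have e1 : ∀ t, (∫ z, ((ω z • ContinuousLinearMap.id ℝ X).comp
        ((continuousMultilinearCurryFin0 ℝ (Euc n) X).toContinuousLinearEquiv :
          (ContinuousMultilinearMap ℝ (fun _ : Fin 0 => Euc n) X) →L[ℝ] X)) (iteratedFDeriv ℝ 0 f (cey x z t))) = ∫ z, ω z • f (cey x z t) := by
      intro t
      rfl
    replace hftc := hftc.trans (congrArg₂ (fun a b => a - b) (e1 1) (e1 0))
    simp only [cey_one, cey_zero] at hftc
    have e2 : ∫ z, ω z • f x = f x := by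
      rw [integral_smul_const, φ.integral_normed, one_smul]
    rw [e2] at hftc
    simp only [pow_zero, one_smul, neg_smul, _root_.neg_apply, integral_neg]
    rw [intervalIntegral.integral_neg, hftc]
    simp only [_root_.smul_apply, ContinuousLinearMap.id_apply]
    abel
  | succ N ih =>
    obtain ⟨G0, G1, h0, h1, hT⟩ := ih
    obtain ⟨G2, h2, hG2⟩ := ce_ibp_iter (N + 1) h1
    refine ⟨_, _, h0.add (h2.smul ((N + 1 : ℝ)⁻¹)),
      (cenext_wt (N + 1) h1).smul (-(N + 1 : ℝ)⁻¹), fun f hf x => ?_⟩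
    set h : ℝ → X := fun t => ∫ z, G1 (x, z) (iteratedFDeriv ℝ (N + 1) f (cey x z t)) with hh
    set h' : ℝ → X := fun t => ∫ z, cenext (N + 1) G1 (x, z)
      (iteratedFDeriv ℝ (N + 1 + 1) f (cey x z t)) with hh'
    have hd : ∀ t, HasDerivAt h (h' t) t := fun t => ce_step (N + 1) h1 hf x t
    have hc : Continuous h := ce_cont (N + 1) h1 hf x
    have hc' : Continuous h' := ce_cont (N + 1 + 1) (cenext_wt (N + 1) h1) hf x
    have hprod : ∀ t : ℝ, HasDerivAt (fun t : ℝ => t ^ (N + 1) • h t)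
        (t ^ (N + 1) • h' t + ((N + 1 : ℝ) * t ^ N) • h t) t := by
      intro t
      have := (hasDerivAt_pow (N + 1) t).smul (hd t)
      simp only [Nat.cast_add, Nat.cast_one, Nat.add_sub_cancel] at this
      exact this
    have hi1 : IntervalIntegrable (fun t : ℝ => t ^ (N + 1) • h' t) volume 0 1 :=
      (by fun_prop : Continuous fun t : ℝ => t ^ (N + 1) • h' t).intervalIntegrable _ _
    have hi2 : IntervalIntegrable (fun t : ℝ => ((N + 1 : ℝ) * t ^ N) • h t) volume 0 1 :=
      (by fun_prop : Continuous fun t : ℝ => ((N + 1 : ℝ) * t ^ N) • h t).intervalIntegrable _ _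
    have hftc := intervalIntegral.integral_eq_sub_of_hasDerivAt (a := 0) (b := 1)
      (fun t _ => hprod t) (hi1.add hi2)
    rw [intervalIntegral.integral_add hi1 hi2] at hftc
    simp only [mul_smul, intervalIntegral.integral_smul, one_pow, one_smul, ne_eq,
      Nat.add_eq_zero_iff, one_ne_zero, and_false, not_false_eq_true, zero_pow, zero_smul,
      sub_zero] at hftc
    have hone : h 1 = ∫ z, G2 (x, z) (f z) := by
      have := hG2 f hf x 1
      rw [one_pow, one_smul] at this
      refine this.trans ?_
      simp only [cey_one]
    rw [hT f hf x]
    simp only [_root_.add_apply, _root_.smul_apply, integral_smul]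
    have e0 : ∫ z, (G0 (x, z) (f z) + (N + 1 : ℝ)⁻¹ • G2 (x, z) (f z)) =
        (∫ z, G0 (x, z) (f z)) + (N + 1 : ℝ)⁻¹ • ∫ z, G2 (x, z) (f z) := by
      rw [← integral_smul]
      exact integral_add (h0.integrable x hf.continuous)
        ((h2.integrable x hf.continuous).smul ((N + 1 : ℝ)⁻¹))
    rw [e0, ← hone]
    change _ + ∫ t in (0 : ℝ)..1, t ^ N • h t = _ + ∫ t in (0 : ℝ)..1, t ^ (N + 1) • (-(N + 1 : ℝ)⁻¹) • h' t
    have hN : (N + 1 : ℝ) ≠ 0 := by positivity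
    have e3 : ∫ t in (0 : ℝ)..1, t ^ N • h t =
        (N + 1 : ℝ)⁻¹ • h 1 - (N + 1 : ℝ)⁻¹ • ∫ t in (0 : ℝ)..1, t ^ (N + 1) • h' t := by
      rw [← smul_sub, ← hftc, add_sub_cancel_left, smul_smul, inv_mul_cancel₀ hN, one_smul]
    have e4 : ∫ t in (0 : ℝ)..1, t ^ (N + 1) • (-(N + 1 : ℝ)⁻¹) • h' t =
        -((N + 1 : ℝ)⁻¹ • ∫ t in (0 : ℝ)..1, t ^ (N + 1) • h' t) := by
      rw [← intervalIntegral.integral_smul, ← intervalIntegral.integral_neg]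
      refine intervalIntegral.integral_congr fun t _ => ?_
      simp only [neg_smul, smul_neg]
      rw [smul_comm]
    rw [e3, e4]
    abel
end weights


theorem ce_opApply_smooth (A : OpCoeff n k V W) {u : Euc n → V} (hu : ContDiff ℝ (⊤ : ℕ∞) u) :
    ContDiff ℝ (⊤ : ℕ∞) (opApply A u) := by
  rw [ce_opApply_eq A u]
  exact A.contDiff.comp (ce_iter_smooth k hu)

/-- The representation formula for globally smooth maps. -/
theorem ce_reprG (A : OpCoeff n k V W) (hA : IsCElliptic A) (l : ℕ) (hl : l + 1 ≤ k) :
    ∃ (G0 : Euc n × Euc n → (V →L[ℝ] ContinuousMultilinearMap ℝ (fun _ : Fin l => Euc n) V))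
      (G1 : Euc n × Euc n → (W →L[ℝ] ContinuousMultilinearMap ℝ (fun _ : Fin l => Euc n) V)),
      ceWt G0 ∧ ceWt G1 ∧ ∀ u : Euc n → V, ContDiff ℝ (⊤ : ℕ∞) u → ∀ x,
        iteratedFDeriv ℝ l u x = (∫ z, G0 (x, z) (u z)) +
          ∫ t in (0 : ℝ)..1, t ^ (k - l - 1) • ∫ z, G1 (x, z) (opApply A u (cey x z t)) := by
  obtain ⟨m0, hm0⟩ := ce_repr_deriv A hA
  obtain ⟨m, hm, hkm⟩ : ∃ m, m0 ≤ m ∧ k ≤ m := ⟨max m0 k, le_max_left _ _, le_max_right _ _⟩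
  have hN : (m - l - 1) + 1 + l = m := by omega
  obtain ⟨L, hL⟩ := hm0 m hm hkm _ _ hN
  have : CompleteSpace (ContinuousMultilinearMap ℝ (fun _ : Fin l => Euc n) V) :=
    FiniteDimensional.complete ℝ _
  obtain ⟨G0, G1, h0, h1, hT⟩ := ce_taylor (n := n)
    (X := ContinuousMultilinearMap ℝ (fun _ : Fin l => Euc n) V) (m - l - 1)
  obtain ⟨G0', h0', e0⟩ := ce_ibp_iter l h0
  obtain ⟨G1', h1', e1⟩ := ce_ibp_iter (m - k) (h1.comp L)
  refine ⟨G0', G1', h0', h1', fun u hu x => ?_⟩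
  rw [hT _ (ce_iter_smooth l hu) x]
  congr 1
  · have := e0 u hu x 1
    simpa only [one_pow, one_smul, cey_one] using this
  · refine intervalIntegral.integral_congr fun t _ => ?_
    have := e1 _ (ce_opApply_smooth A hu) x t
    beta_reduce
    rw [← this, smul_smul, ← pow_add]
    have e : k - l - 1 + (m - k) = m - l - 1 := by omega
    rw [e]
    congr 2
    funext z
    rw [hL u hu]
    rfl

theorem ceWt.bound {X Y : Type*} [NormedAddCommGroup X] [NormedSpace ℝ X]
    [NormedAddCommGroup Y] [NormedSpace ℝ Y] {G : Euc n × Euc n → (X →L[ℝ] Y)} (hG : ceWt G) :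
    ∃ C : NNReal, ∀ f : Euc n → X, ∀ x ∈ closedBall (0 : Euc n) 1,
      ‖∫ z, G (x, z) (f z)‖ₑ ≤ C * ∫⁻ z in closedBall (0 : Euc n) (1 / 2), ‖f z‖ₑ := by
  obtain ⟨C, hC⟩ := ((isCompact_closedBall (0 : Euc n) 1).prod
    (isCompact_closedBall (0 : Euc n) (1 / 2))).exists_bound_of_continuousOn
      hG.1.continuous.continuousOn
  refine ⟨C.toNNReal, fun f x hx => ?_⟩
  refine (enorm_integral_le_lintegral_enorm _).trans ?_
  rw [← lintegral_const_mul' _ _ ENNReal.coe_ne_top,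
    ← lintegral_indicator measurableSet_closedBall]
  refine lintegral_mono fun z => ?_
  by_cases hz : z ∈ closedBall (0 : Euc n) (1 / 2)
  · rw [Set.indicator_of_mem hz]
    refine ((G (x, z)).le_opENorm (f z)).trans ?_
    gcongr
    have := hC (x, z) ⟨hx, hz⟩
    rw [← ofReal_norm]
    exact ENNReal.ofReal_le_ofReal this
  · rw [Set.indicator_of_notMem hz, hG.2 x z (by simpa using hz)]
    simp

theorem ce_bound (A : OpCoeff n k V W) (hA : IsCElliptic A) (l : ℕ) (hl : l + 1 ≤ k) :
    ∃ C : NNReal, ∀ u : Euc n → V, ContDiff ℝ (⊤ : ℕ∞) u → ∀ x ∈ closedBall (0 : Euc n) 1,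
      ‖iteratedFDeriv ℝ l u x‖ₑ ≤ C * (∫⁻ z in closedBall (0 : Euc n) (1 / 2), ‖u z‖ₑ) +
        C * ∫⁻ t in Set.Ioc (0 : ℝ) 1, ∫⁻ z in closedBall (0 : Euc n) (1 / 2),
          ‖opApply A u (cey x z t)‖ₑ := by
  obtain ⟨G0, G1, h0, h1, hrep⟩ := ce_reprG A hA l hl
  obtain ⟨C0, hC0⟩ := h0.bound
  obtain ⟨C1, hC1⟩ := h1.bound
  refine ⟨max C0 C1, fun u hu x hx => ?_⟩
  rw [hrep u hu x]
  refine (enorm_add_le _ _).trans (add_le_add ?_ ?_)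
  · refine (hC0 u x hx).trans ?_
    gcongr
    exact le_max_left _ _
  · rw [intervalIntegral.integral_of_le zero_le_one]
    refine (enorm_integral_le_lintegral_enorm _).trans ?_
    rw [← lintegral_const_mul' _ _ ENNReal.coe_ne_top]
    refine setLIntegral_mono' measurableSet_Ioc fun t ht => ?_
    rw [enorm_smul]
    have h1 : ‖t ^ (k - l - 1)‖ₑ ≤ 1 := by
      rw [← ofReal_norm, ENNReal.ofReal_le_one, norm_pow, Real.norm_of_nonneg ht.1.le]
      exact pow_le_one₀ ht.1.le ht.2
    calc _ ≤ 1 * ‖∫ z, G1 (x, z) (opApply A u (cey x z t))‖ₑ := by gcongr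
      _ ≤ _ := by
        rw [one_mul]
        refine (hC1 (fun z => opApply A u (cey x z t)) x hx).trans ?_
        gcongr
        exact le_max_right _ _

theorem ce_bound_local (A : OpCoeff n k V W) (hA : IsCElliptic A) (l : ℕ) (hl : l + 1 ≤ k) :
    ∃ C : NNReal, ∀ u : Euc n → V, ContDiffOn ℝ (⊤ : ℕ∞) u (closedBall 0 1) →
      ∀ x ∈ ball (0 : Euc n) 1,
      ‖iteratedFDeriv ℝ l u x‖ₑ ≤ C * (∫⁻ z in closedBall (0 : Euc n) (1 / 2), ‖u z‖ₑ) +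
        C * ∫⁻ t in Set.Ioc (0 : ℝ) 1, ∫⁻ z in closedBall (0 : Euc n) (1 / 2),
          ‖opApply A u (cey x z t)‖ₑ := by
  obtain ⟨C, hC⟩ := ce_bound A hA l hl
  refine ⟨C, fun u hu x hx => ?_⟩
  have hx1 : ‖x‖ < 1 := by simpa using hx
  obtain ⟨r, hr, hr1⟩ := exists_between (max_lt hx1 (by norm_num : (1 / 2 : ℝ) < 1))
  obtain ⟨R, hrR, hR1⟩ := exists_between hr1
  have hxr : ‖x‖ < r := (le_max_left _ _).trans_lt hr
  have h2r : 1 / 2 < r := (le_max_right _ _).trans_lt hr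
  let χ : ContDiffBump (0 : Euc n) := ⟨r, R, by linarith, hrR⟩
  have hs : ContDiff ℝ (⊤ : ℕ∞) (fun y => χ y • u y) := by
    rw [contDiff_iff_contDiffAt]
    intro y
    by_cases hy : ‖y‖ < 1
    · exact χ.contDiff.contDiffAt.smul (hu.contDiffAt
        (Filter.mem_of_superset (isOpen_ball.mem_nhds (by simpa using hy)) ball_subset_closedBall))
    · have : (fun y => χ y • u y) =ᶠ[nhds y] fun _ => 0 := by
        have hy' : y ∉ tsupport χ := by
          rw [χ.tsupport_eq]
          simp only [mem_closedBall, dist_zero_right, not_le]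
          show R < ‖y‖
          linarith
        have h3 := notMem_tsupport_iff_eventuallyEq.1 hy'
        filter_upwards [h3] with w hw
        rw [hw]
        simp
      exact contDiffAt_const.congr_of_eventuallyEq this
  have he : ∀ y ∈ ball (0 : Euc n) r, (fun y => χ y • u y) =ᶠ[nhds y] u := by
    intro y hy
    filter_upwards [isOpen_ball.mem_nhds hy] with w hw
    rw [χ.one_of_mem_closedBall (ball_subset_closedBall hw), one_smul]
  have hxr' : x ∈ ball (0 : Euc n) r := by simpa using hxr
  have hsub : closedBall (0 : Euc n) (1 / 2) ⊆ ball 0 r := closedBall_subset_ball h2r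
  have := hC _ hs x (ball_subset_closedBall hx)
  rw [(Filter.EventuallyEq.iteratedFDeriv ℝ (he x hxr') l).eq_of_nhds] at this
  refine this.trans (le_of_eq ?_)
  congr 2
  · refine setLIntegral_congr_fun measurableSet_closedBall fun z hz => ?_
    rw [(he z (hsub hz)).eq_of_nhds]
  · refine setLIntegral_congr_fun measurableSet_Ioc fun t ht => ?_
    refine setLIntegral_congr_fun measurableSet_closedBall fun z hz => ?_
    have hy : cey x z t ∈ ball (0 : Euc n) r :=
      (convex_ball (0 : Euc n) r).add_smul_sub_mem hxr' (hsub hz) ⟨ht.1.le, ht.2⟩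
    simp only [opApply]
    rw [(Filter.EventuallyEq.iteratedFDeriv ℝ (he _ hy) k).eq_of_nhds]


theorem ce_scale (a : Euc n) {s : ℝ} (hs : 1 / 2 ≤ s) {g : Euc n → ℝ≥0∞} (hg : Measurable g) :
    ∫⁻ z, g (a + s • z) ≤ 2 ^ n * ∫⁻ z, g z := by
  have h1 : ∫⁻ z, g (a + s • z) = ∫⁻ y, g (a + y) ∂(Measure.map (s • ·) volume) := by
    rw [lintegral_map (by fun_prop) (by fun_prop)]
  rw [h1, Measure.map_addHaar_smul _ (by linarith), lintegral_smul_measure,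
    lintegral_add_left_eq_self (μ := volume) g a]
  simp only [finrank_euclideanSpace, Fintype.card_fin, smul_eq_mul]
  gcongr
  have h2 : (2 : ℝ≥0∞) ^ n = ENNReal.ofReal (2 ^ n) := by
    rw [ENNReal.ofReal_pow (by norm_num)]; simp
  rw [h2]
  refine ENNReal.ofReal_le_ofReal ?_
  rw [abs_of_nonneg (by positivity), ← inv_pow]
  refine pow_le_pow_left₀ (by positivity) ?_ n
  rw [inv_le_comm₀ (by linarith) (by norm_num)]
  linarith

theorem ce_cey_meas {g : Euc n → ℝ≥0∞} (hg : Measurable g) :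
    Measurable (fun q : Euc n × (ℝ × Euc n) => g (cey q.1 q.2.2 q.2.1)) := by
  refine hg.comp ?_
  unfold cey
  fun_prop

theorem ce_cey_meas' {g : Euc n → ℝ≥0∞} (hg : Measurable g) (x : Euc n) :
    Measurable (fun q : ℝ × Euc n => g (cey x q.2 q.1)) :=
  (ce_cey_meas hg).comp measurable_prodMk_left

theorem ce_key {g : Euc n → ℝ≥0∞} (hg : Measurable g) (t : ℝ) :
    ∫⁻ x in ball (0 : Euc n) 1, ∫⁻ z in ball (0 : Euc n) 1, g (cey x z t) ≤
      (2 ^ n * volume (ball (0 : Euc n) 1)) * ∫⁻ z, g z := by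
  have hm : Measurable (fun q : Euc n × Euc n => g (cey q.1 q.2 t)) := by
    refine hg.comp ?_
    unfold cey
    fun_prop
  rcases le_total (1 / 2) t with ht | ht
  · calc _ ≤ ∫⁻ x in ball (0 : Euc n) 1, (2 ^ n * ∫⁻ z, g z) := by
          refine lintegral_mono fun x => ?_
          refine (setLIntegral_le_lintegral _ _).trans ?_
          have : ∀ z, cey x z t = (x - t • x) + t • z := fun z => by
            unfold cey; rw [smul_sub]; abel
          simp only [this]
          exact ce_scale _ ht hg
      _ = _ := by
          rw [setLIntegral_const]; ring
  · rw [lintegral_lintegral_swap hm.aemeasurable]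
    calc _ ≤ ∫⁻ z in ball (0 : Euc n) 1, (2 ^ n * ∫⁻ z, g z) := by
          refine lintegral_mono fun z => ?_
          refine (setLIntegral_le_lintegral _ _).trans ?_
          have : ∀ x, cey x z t = (t • z) + (1 - t) • x := fun x => by
            unfold cey; rw [smul_sub, sub_smul, one_smul]; abel
          simp only [this]
          exact ce_scale _ (by linarith) hg
      _ = _ := by
          rw [setLIntegral_const]; ring

/-- The averaged operator. -/
def ceAv (g : Euc n → ℝ≥0∞) (x : Euc n) : ℝ≥0∞ :=
  ∫⁻ q, g (cey x q.2 q.1)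
    ∂((volume.restrict (Set.Ioc (0 : ℝ) 1)).prod (volume.restrict (ball (0 : Euc n) 1)))

theorem ceAv_meas {g : Euc n → ℝ≥0∞} (hg : Measurable g) : Measurable (ceAv g) :=
  (ce_cey_meas hg).lintegral_prod_right'

theorem ceAv_key {g : Euc n → ℝ≥0∞} (hg : Measurable g) :
    ∫⁻ x in ball (0 : Euc n) 1, ceAv g x ≤
      (2 ^ n * volume (ball (0 : Euc n) 1)) * ∫⁻ z, g z := by
  unfold ceAv
  rw [lintegral_lintegral_swap (ce_cey_meas hg).aemeasurable]
  have hm : Measurable (fun q : ℝ × Euc n => ∫⁻ x in ball (0 : Euc n) 1, g (cey x q.2 q.1)) :=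
    (ce_cey_meas hg).lintegral_prod_left'
  rw [lintegral_prod _ hm.aemeasurable]
  calc _ ≤ ∫⁻ t in Set.Ioc (0 : ℝ) 1, ((2 ^ n * volume (ball (0 : Euc n) 1)) * ∫⁻ z, g z) := by
        refine lintegral_mono fun t => ?_
        have hm : Measurable (fun q : Euc n × Euc n => g (cey q.1 q.2 t)) := by
          refine hg.comp ?_
          unfold cey
          fun_prop
        simp only
        rw [← lintegral_lintegral_swap hm.aemeasurable]
        exact ce_key hg t
    _ = _ := by
        rw [setLIntegral_const]
        simp

theorem ceAv_top {g : Euc n → ℝ≥0∞} (hg : Measurable g) (x : Euc n) :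
    ceAv g x ≤ volume (ball (0 : Euc n) 1) * eLpNorm g ∞ volume := by
  have hm : Measurable (fun q : ℝ × Euc n => g (cey x q.2 q.1)) :=
    (ce_cey_meas hg).comp measurable_prodMk_left
  unfold ceAv
  rw [lintegral_prod _ hm.aemeasurable]
  calc _ ≤ ∫⁻ t in Set.Ioc (0 : ℝ) 1, (volume (ball (0 : Euc n) 1) * eLpNorm g ∞ volume) := by
        refine setLIntegral_mono' measurableSet_Ioc fun t ht => ?_
        calc _ ≤ ∫⁻ z in ball (0 : Euc n) 1, eLpNorm g ∞ volume := by
              refine lintegral_mono_ae (ae_restrict_of_ae ?_)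
              have h0 : ∀ᵐ y : Euc n, g y ≤ eLpNorm g ∞ volume := by
                rw [eLpNorm_exponent_top]
                exact ae_le_eLpNormEssSup (f := g)
              have hq : Measure.QuasiMeasurePreserving (fun z : Euc n => (x - t • x) + t • z)
                  volume volume :=
                (measurePreserving_add_left volume (x - t • x)).quasiMeasurePreserving.comp
                  (Measure.quasiMeasurePreserving_smul volume ht.1.ne')
              filter_upwards [hq.ae h0] with z hz
              have : cey x z t = (x - t • x) + t • z := by
                unfold cey; rw [smul_sub]; abel
              simp only [this]
              exact hz
          _ = _ := by rw [setLIntegral_const, mul_comm]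
    _ = _ := by
        rw [setLIntegral_const]
        simp

theorem ce_ball_fin : volume (ball (0 : Euc n) 1) ≠ ∞ := measure_ball_lt_top.ne

/-- `L^p` boundedness of the averaged operator. -/
theorem ceAv_Lp (p : ℝ≥0∞) (hp : 1 ≤ p) : ∃ C : ℝ≥0∞, C ≠ ∞ ∧ ∀ g : Euc n → ℝ≥0∞,
    Measurable g → eLpNorm (ceAv g) p (volume.restrict (ball (0 : Euc n) 1)) ≤
      C * eLpNorm g p volume := by
  by_cases hpt : p = ∞
  · subst hpt
    refine ⟨volume (ball (0 : Euc n) 1), ce_ball_fin, fun g hg => ?_⟩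
    rw [eLpNorm_exponent_top (f := ceAv g)]
    exact essSup_le_of_ae_le _ (Filter.Eventually.of_forall fun x => ceAv_top hg x)
  have hp0 : p ≠ 0 := (zero_lt_one.trans_le hp).ne'
  have hpr : 0 < p.toReal := ENNReal.toReal_pos hp0 hpt
  have hpr1 : 1 ≤ p.toReal := by
    rw [← ENNReal.toReal_one]; exact ENNReal.toReal_mono hpt hp
  set ν : Measure (ℝ × Euc n) :=
    (volume.restrict (Set.Ioc (0 : ℝ) 1)).prod (volume.restrict (ball (0 : Euc n) 1)) with hν
  set c : ℝ≥0∞ := ν Set.univ ^ (1 / (1 : ℝ≥0∞).toReal - 1 / p.toReal) with hc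
  have hνu : ν Set.univ ≠ ∞ := by
    rw [hν, ← Set.univ_prod_univ, Measure.prod_prod]
    simp only [Measure.restrict_apply_univ]
    exact ENNReal.mul_ne_top (by simp) ce_ball_fin
  have hcf : c ≠ ∞ := by
    refine ENNReal.rpow_ne_top_of_nonneg ?_ hνu
    simp only [ENNReal.toReal_one, div_one, sub_nonneg]
    rw [div_le_one hpr]; exact hpr1
  refine ⟨c * (2 ^ n * volume (ball (0 : Euc n) 1)) ^ (1 / p.toReal), ?_, fun g hg => ?_⟩
  · refine ENNReal.mul_ne_top hcf (ENNReal.rpow_ne_top_of_nonneg (by positivity) ?_)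
    exact ENNReal.mul_ne_top (by simp) ce_ball_fin
  have hgp : Measurable (fun y => g y ^ p.toReal) := hg.pow_const _
  have h1 : ∀ x, ceAv g x ≤ c * (ceAv (fun y => g y ^ p.toReal) x) ^ (1 / p.toReal) := by
    intro x
    have hm : Measurable (fun q : ℝ × Euc n => g (cey x q.2 q.1)) :=
      (ce_cey_meas hg).comp measurable_prodMk_left
    have := eLpNorm_le_eLpNorm_mul_rpow_measure_univ (μ := ν) hp hm.aestronglyMeasurable
    rw [eLpNorm_one_eq_lintegral_enorm, eLpNorm_eq_lintegral_rpow_enorm_toReal hp0 hpt] at this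
    rw [mul_comm]
    exact this
  clear_value c
  rw [eLpNorm_eq_lintegral_rpow_enorm_toReal hp0 hpt,
    eLpNorm_eq_lintegral_rpow_enorm_toReal hp0 hpt]
  simp only [enorm_eq_self]
  calc _ ≤ (∫⁻ x in ball (0 : Euc n) 1, c ^ p.toReal * ceAv (fun y => g y ^ p.toReal) x)
          ^ (1 / p.toReal) := by
        gcongr with x
        refine (ENNReal.rpow_le_rpow (h1 x) hpr.le).trans (le_of_eq ?_)
        rw [ENNReal.mul_rpow_of_nonneg _ _ hpr.le, ← ENNReal.rpow_mul, one_div_mul_cancel hpr.ne',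
          ENNReal.rpow_one]
    _ ≤ (c ^ p.toReal * ((2 ^ n * volume (ball (0 : Euc n) 1)) * ∫⁻ z, g z ^ p.toReal))
          ^ (1 / p.toReal) := by
        rw [lintegral_const_mul _ (ceAv_meas hgp)]
        gcongr
        exact ceAv_key hgp
    _ = _ := by
        rw [ENNReal.mul_rpow_of_nonneg _ _ (by positivity),
          ENNReal.mul_rpow_of_nonneg _ _ (by positivity), ← ENNReal.rpow_mul,
          mul_one_div_cancel hpr.ne', ENNReal.rpow_one, mul_assoc]

/-- If `𝔸` is ℂ-elliptic of order `k`, then for every `1 ≤ p ≤ ∞` and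
`1 ≤ l ≤ k − 1` there is `c > 0` with
`‖D^l u‖_{L^p(B)} ≤ c (‖u‖_{L^p(B)} + ‖𝔸u‖_{L^p(B)})` for all `u ∈ C^∞(cl B, V)`. -/
theorem statement16 (hn : 1 < n) (A : OpCoeff n k V W) (hA : IsCElliptic A)
    (p : ℝ≥0∞) (hp : 1 ≤ p) (l : ℕ) (hl1 : 1 ≤ l) (hl2 : l ≤ k - 1) :
    ∃ c : ℝ, 0 < c ∧ ∀ u : Euc n → V, ContDiffOn ℝ (⊤ : ℕ∞) u (closedBall 0 1) →
      eLpNorm (fun x => iteratedFDeriv ℝ l u x) p (volume.restrict (ball (0 : Euc n) 1))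
        ≤ ENNReal.ofReal c *
          (eLpNorm u p (volume.restrict (ball (0 : Euc n) 1))
            + eLpNorm (fun x => opApply A u x) p (volume.restrict (ball (0 : Euc n) 1))) := by
  obtain ⟨C, hC⟩ := ce_bound_local A hA l (by omega)
  obtain ⟨K, hK, hKg⟩ := ceAv_Lp (n := n) p hp
  have hp0 : p ≠ 0 := (zero_lt_one.trans_le hp).ne'
  set μ : Measure (Euc n) := volume.restrict (ball (0 : Euc n) 1) with hμ
  have hμu : μ Set.univ ≠ ∞ := by
    rw [hμ, Measure.restrict_apply_univ]; exact ce_ball_fin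
  have : IsFiniteMeasure μ := ⟨hμu.lt_top⟩
  -- the constants
  let c1 : ℝ≥0∞ := μ Set.univ ^ (1 / (1 : ℝ≥0∞).toReal - 1 / p.toReal)
  have hc1 : c1 ≠ ∞ := by
    refine ENNReal.rpow_ne_top_of_nonneg ?_ hμu
    simp only [ENNReal.toReal_one, div_one, sub_nonneg]
    by_cases hpt : p = ∞
    · simp [hpt]
    have hpr1 : 1 ≤ p.toReal := by
      rw [← ENNReal.toReal_one]; exact ENNReal.toReal_mono hpt hp
    rw [div_le_one (by linarith)]; exact hpr1
  let c2 : ℝ≥0∞ := eLpNorm (fun _ : Euc n => (1 : ℝ)) p μ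
  have hc2 : c2 ≠ ∞ := (memLp_const (1 : ℝ)).eLpNorm_ne_top
  let D : ℝ≥0∞ := C * c1 * c2 + C * K + 1
  have hD : D ≠ ∞ := by
    simp only [D]
    exact ENNReal.add_ne_top.2 ⟨ENNReal.add_ne_top.2
      ⟨ENNReal.mul_ne_top (ENNReal.mul_ne_top ENNReal.coe_ne_top hc1) hc2,
        ENNReal.mul_ne_top ENNReal.coe_ne_top hK⟩, ENNReal.one_ne_top⟩
  have hD0 : D ≠ 0 := by simp [D]
  refine ⟨D.toReal, ENNReal.toReal_pos hD0 hD, fun u hu => ?_⟩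
  rw [ENNReal.ofReal_toReal hD]
  have hsub : closedBall (0 : Euc n) (1 / 2) ⊆ ball 0 1 := closedBall_subset_ball (by norm_num)
  have hum : AEStronglyMeasurable u μ :=
    (hu.continuousOn.mono ball_subset_closedBall).aestronglyMeasurable measurableSet_ball
  have hud : ContinuousOn (opApply A u) (ball (0 : Euc n) 1) := by
    intro x hx
    have hx' : ContDiffAt ℝ (⊤ : ℕ∞) u x := hu.contDiffAt
      (Filter.mem_of_superset (isOpen_ball.mem_nhds hx) ball_subset_closedBall)
    have h2 : ContDiffAt ℝ (⊤ : ℕ∞) (iteratedFDeriv ℝ k u) x :=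
      hx'.iteratedFDeriv_right (by exact_mod_cast le_top)
    exact (A.continuous.continuousAt.comp h2.continuousAt).continuousWithinAt
  let g : Euc n → ℝ≥0∞ := (ball (0 : Euc n) 1).indicator fun x => ‖opApply A u x‖ₑ
  have hg : Measurable g := by
    classical
    have h3 : Measurable ((ball (0 : Euc n) 1).piecewise (fun x => ‖opApply A u x‖ₑ)
        0) := by
      refine ContinuousOn.measurable_piecewise ?_ continuous_zero.continuousOn measurableSet_ball
      exact continuous_enorm.comp_continuousOn hud
    rwa [Set.piecewise_eq_indicator] at h3
  have hgn : eLpNorm g p volume = eLpNorm (fun x => opApply A u x) p μ := by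
    rw [hμ, ← eLpNorm_enorm (fun x => opApply A u x)]
    exact eLpNorm_indicator_eq_eLpNorm_restrict measurableSet_ball
  let I : ℝ≥0∞ := ∫⁻ z, ‖u z‖ₑ ∂μ
  have hI : I ≤ c1 * eLpNorm u p μ := by
    have h4 := eLpNorm_le_eLpNorm_mul_rpow_measure_univ (μ := μ) hp hum
    rw [eLpNorm_one_eq_lintegral_enorm, mul_comm] at h4
    exact h4
  have hpt : ∀ᵐ x ∂μ, ‖iteratedFDeriv ℝ l u x‖ₑ ≤ ‖C * I + C * ceAv g x‖ₑ := by
    refine (ae_restrict_iff' measurableSet_ball).2 (Filter.Eventually.of_forall fun x hx => ?_)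
    refine (hC u hu x hx).trans ?_
    rw [enorm_eq_self]
    have hm : Measurable (fun q : ℝ × Euc n => g (cey x q.2 q.1)) :=
      ce_cey_meas' hg x
    have b1 : ∫⁻ z in closedBall (0 : Euc n) (1 / 2), ‖u z‖ₑ ≤ I := lintegral_mono_set hsub
    have b2 : ∫⁻ t in Set.Ioc (0 : ℝ) 1, ∫⁻ z in closedBall (0 : Euc n) (1 / 2),
          ‖opApply A u (cey x z t)‖ₑ ≤ ceAv g x := by
      unfold ceAv
      rw [lintegral_prod _ hm.aemeasurable]
      refine setLIntegral_mono' measurableSet_Ioc fun t ht => ?_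
      refine (lintegral_mono_set hsub).trans ?_
      refine setLIntegral_mono' measurableSet_ball fun z hz => ?_
      have hy : cey x z t ∈ ball (0 : Euc n) 1 :=
        (convex_ball (0 : Euc n) 1).add_smul_sub_mem hx hz ⟨ht.1.le, ht.2⟩
      simp only [g]
      rw [Set.indicator_of_mem hy]
    exact add_le_add (mul_le_mul_right b1 _) (mul_le_mul_right b2 _)
  have hconst : ∀ a : ℝ≥0∞, eLpNorm (fun _ : Euc n => a) p μ = a * c2 := by
    intro a
    by_cases h0 : μ = 0
    · simp [c2, h0]
    simp only [c2]
    rw [eLpNorm_const _ hp0 h0, eLpNorm_const _ hp0 h0]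
    simp
  have hav : eLpNorm (fun x => (C : ℝ≥0∞) * ceAv g x) p μ ≤ C * eLpNorm (ceAv g) p μ :=
    eLpNorm_le_mul_eLpNorm_of_ae_le_mul' (Filter.Eventually.of_forall fun x => le_rfl) p
  calc _ ≤ eLpNorm (fun x => C * I + C * ceAv g x) p μ := eLpNorm_mono_enorm_ae hpt
    _ ≤ eLpNorm (fun _ : Euc n => C * I) p μ + eLpNorm (fun x => (C : ℝ≥0∞) * ceAv g x) p μ :=
        eLpNorm_add_le aestronglyMeasurable_const
          ((ceAv_meas hg).const_mul _).aestronglyMeasurable hp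
    _ ≤ C * c1 * c2 * eLpNorm u p μ + C * K * eLpNorm (fun x => opApply A u x) p μ := by
        refine add_le_add ?_ ?_
        · rw [hconst]
          calc (C : ℝ≥0∞) * I * c2 ≤ C * (c1 * eLpNorm u p μ) * c2 := by gcongr
            _ = _ := by ring
        · refine hav.trans ?_
          rw [mul_assoc, ← hgn]
          gcongr
          exact hKg g hg
    _ ≤ D * eLpNorm u p μ + D * eLpNorm (fun x => opApply A u x) p μ := by
        gcongr
        · simp only [D]
          rw [add_assoc]
          exact le_self_add
        · simp only [D]
          exact le_add_self.trans le_self_add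
    _ = _ := by rw [mul_add]
end
end

section
/- Let n>1 and let 𝔸 be a first-order (k=1) homogeneous linear constant-coefficient differential operator on ℝⁿ from V to W. If there exist p > 1 and c > 0 such that ‖u‖_{L^p(B)} ≤ c ( ‖𝔸u‖_{L¹(B)} + ‖u‖_{L¹(B)} ) for all u ∈ C^∞(cl(B), V), then 𝔸 is elliptic, i.e. 𝔸[ξ] : V → W is injective for every ξ ∈ ℝⁿ\{0}. -/
noncomputable section

open MeasureTheory Metric
open scoped ENNReal RealInnerProductSpace

variable {n k : ℕ} {V W : Type*}
  [NormedAddCommGroup V] [InnerProductSpace ℝ V] [FiniteDimensional ℝ V]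
  [NormedAddCommGroup W] [InnerProductSpace ℝ W] [FiniteDimensional ℝ W]

lemma s17_measure_tendsto (hn : 1 < n) (ξ : Euc n) (hξ : ξ ≠ 0) :
    Filter.Tendsto (fun k : ℕ => ((volume.restrict (ball (0 : Euc n) 1)).real
      {x | |⟪ξ, x⟫| ≤ 1 / ((k : ℝ) + 1)})) Filter.atTop (nhds 0) := by
  haveI : IsFiniteMeasure (volume.restrict (ball (0 : Euc n) 1)) :=
    ⟨by simpa using measure_ball_lt_top⟩
  set μ := volume.restrict (ball (0 : Euc n) 1) with hμ
  have hmeas : ∀ k : ℕ, MeasurableSet {x : Euc n | |⟪ξ, x⟫| ≤ 1 / ((k : ℝ) + 1)} := fun k =>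
    (isClosed_le (by fun_prop) continuous_const).measurableSet
  have hT := tendsto_measure_iInter_atTop (μ := μ)
    (s := fun k : ℕ => {x : Euc n | |⟪ξ, x⟫| ≤ 1 / ((k : ℝ) + 1)})
    (fun k => (hmeas k).nullMeasurableSet)
    (fun a b hab x hx => by
      simp only [Set.mem_setOf_eq] at hx ⊢
      exact le_trans hx (Nat.one_div_le_one_div hab))
    ⟨0, measure_ne_top _ _⟩
  have hz : μ (⋂ k : ℕ, {x : Euc n | |⟪ξ, x⟫| ≤ 1 / ((k : ℝ) + 1)}) = 0 := by
    have hsub : (⋂ k : ℕ, {x : Euc n | |⟪ξ, x⟫| ≤ 1 / ((k : ℝ) + 1)}) ⊆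
        ((LinearMap.ker (innerSL ℝ ξ).toLinearMap : Submodule ℝ (Euc n)) : Set (Euc n)) := by
      intro x hx
      simp only [Set.mem_iInter, Set.mem_setOf_eq] at hx
      have h0 : |⟪ξ, x⟫| ≤ 0 := ge_of_tendsto' tendsto_one_div_add_atTop_nhds_zero_nat hx
      have : ⟪ξ, x⟫ = 0 := abs_eq_zero.mp (le_antisymm h0 (abs_nonneg _))
      simpa using this
    refine measure_mono_null hsub ?_
    refine Measure.absolutelyContinuous_of_le Measure.restrict_le_self ?_
    apply Measure.addHaar_submodule
    intro htop
    have : ξ ∈ (LinearMap.ker (innerSL ℝ ξ).toLinearMap : Submodule ℝ (Euc n)) := by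
      rw [htop]; trivial
    apply hξ
    simpa using this
  rw [hz] at hT
  exact (ENNReal.tendsto_toReal ENNReal.zero_ne_top).comp hT

lemma s17_opApply (A : OpCoeff n 1 V W) (ξ : Euc n) (v : V) (hv : symbol A ξ v = 0)
    (f : ℝ → ℝ) (hf : Differentiable ℝ f) (x : Euc n) :
    opApply A (fun x => f ⟪ξ, x⟫ • v) x = 0 := by
  have hd : HasFDerivAt (fun x : Euc n => f ⟪ξ, x⟫ • v)
      ((deriv f ⟪ξ, x⟫ • (innerSL ℝ ξ)).smulRight v) x := by
    have h1 : HasFDerivAt (fun x : Euc n => ⟪ξ, x⟫) (innerSL ℝ ξ) x :=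
      (innerSL ℝ ξ).hasFDerivAt
    exact ((hf _).hasDerivAt.comp_hasFDerivAt x h1).smul_const v
  have : iteratedFDeriv ℝ 1 (fun x : Euc n => f ⟪ξ, x⟫ • v) x
      = deriv f ⟪ξ, x⟫ • symTensor n 1 ξ v := by
    ext m
    rw [iteratedFDeriv_one_apply, hd.fderiv]
    simp [symTensor, mul_smul]
  unfold opApply
  rw [this, map_smul]
  change _ • symbol A ξ v = 0
  rw [hv, smul_zero]

lemma s17_bound (A : OpCoeff n 1 V W) (ξ : Euc n) (v : V) (hv0 : v ≠ 0)
    (hv : symbol A ξ v = 0) (p c : ℝ) (hp : 1 < p)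
    (h : ∀ u : Euc n → V, ContDiffOn ℝ (⊤ : ℕ∞) u (closedBall 0 1) →
        (∫ x in ball (0 : Euc n) 1, ‖u x‖ ^ p) ^ (1 / p)
          ≤ c * ((∫ x in ball (0 : Euc n) 1, ‖opApply A u x‖)
              + ∫ x in ball (0 : Euc n) 1, ‖u x‖))
    (hc : 0 < c) (ε : ℝ) (hε : 0 < ε) :
    1 ≤ c * ((volume.restrict (ball (0 : Euc n) 1)).real
      {x | |⟪ξ, x⟫| ≤ ε}) ^ (1 / p.conjExponent) := by
  haveI : IsFiniteMeasure (volume.restrict (ball (0 : Euc n) 1)) :=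
    ⟨by simpa using measure_ball_lt_top⟩
  let b : ContDiffBump (0 : ℝ) := ⟨ε / 2, ε, by positivity, by linarith⟩
  let u : Euc n → V := fun x => b ⟪ξ, x⟫ • v
  have hb : ContDiff ℝ (⊤ : ℕ∞) (b : ℝ → ℝ) := b.contDiff
  have hu : ContDiff ℝ (⊤ : ℕ∞) u :=
    (hb.comp (innerSL ℝ ξ).contDiff).smul contDiff_const
  have hcont : Continuous u := hu.continuous
  have hcn : Continuous (fun x => ‖u x‖) := hcont.norm
  set S : Set (Euc n) := {x | |⟪ξ, x⟫| ≤ ε} with hS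
  have hSm : MeasurableSet S :=
    (isClosed_le (by fun_prop) continuous_const).measurableSet
  have hsupp : ∀ x, x ∉ S → ‖u x‖ = 0 := by
    intro x hx
    have : ε ≤ |⟪ξ, x⟫| := le_of_lt (not_le.mp hx)
    have hz : b ⟪ξ, x⟫ = 0 := b.zero_of_le_dist (by simpa [Real.dist_eq] using this)
    simp [u, hz]
  have hle : ∀ x, ‖u x‖ ≤ ‖v‖ := by
    intro x
    simp only [u, norm_smul, Real.norm_eq_abs, abs_of_nonneg b.nonneg]
    exact mul_le_of_le_one_left (norm_nonneg _) b.le_one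
  have hH := integral_mul_le_Lp_mul_Lq_of_nonneg
    (μ := volume.restrict (ball (0 : Euc n) 1)) (Real.HolderConjugate.conjExponent hp)
    (f := fun x => ‖u x‖) (g := S.indicator (fun _ => (1 : ℝ)))
    (Filter.Eventually.of_forall fun x => norm_nonneg _)
    (Filter.Eventually.of_forall fun x => Set.indicator_nonneg (fun _ _ => zero_le_one) x)
    (MemLp.of_bound hcn.aestronglyMeasurable ‖v‖
      (Filter.Eventually.of_forall fun x => by simpa using hle x))
    ((memLp_const 1).indicator hSm)
  have e1 : ∀ x, ‖u x‖ * S.indicator (fun _ => (1 : ℝ)) x = ‖u x‖ := by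
    intro x
    by_cases hx : x ∈ S
    · simp [hx]
    · simp [hsupp x hx]
  have hq : p.conjExponent ≠ 0 := (Real.HolderConjugate.conjExponent hp).symm.ne_zero
  have e2 : ∀ x, (S.indicator (fun _ => (1 : ℝ)) x) ^ p.conjExponent
      = S.indicator (fun _ => (1 : ℝ)) x := by
    intro x
    by_cases hx : x ∈ S
    · simp [hx]
    · simp [hx, Real.zero_rpow hq]
  simp only [e1, e2] at hH
  rw [integral_indicator_const _ hSm, smul_eq_mul, mul_one] at hH
  have hmain := h u hu.contDiffOn
  have hop : ∀ x, ‖opApply A u x‖ = 0 := fun x => by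
    rw [s17_opApply A ξ v hv b (hb.differentiable (by simp)) x, norm_zero]
  simp only [hop, integral_zero, zero_add] at hmain
  have hcp : Continuous (fun x => ‖u x‖ ^ p) :=
    hcn.rpow_const fun x => Or.inr (by linarith)
  have hI : 0 < ∫ x in ball (0 : Euc n) 1, ‖u x‖ ^ p := by
    rw [setIntegral_pos_iff_support_of_nonneg_ae
      (Filter.Eventually.of_forall fun x => by positivity)]
    · refine IsOpen.measure_pos _ (hcp.isOpen_support.inter isOpen_ball) ⟨0, ?_, by simp⟩
      have hb0 : b 0 = 1 := b.one_of_mem_closedBall (by simp [b.rIn_pos.le])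
      have : 0 < ‖u 0‖ := by simp [u, hb0, hv0]
      exact (Real.rpow_pos_of_pos this p).ne'
    · exact (hcp.continuousOn.integrableOn_compact (isCompact_closedBall 0 1)).mono_set
        ball_subset_closedBall
  have hI' := Real.rpow_pos_of_pos hI (1 / p)
  have := hmain.trans (mul_le_mul_of_nonneg_left hH hc.le)
  refine le_of_mul_le_mul_left ?_ hI'
  linarith

/-- (`k = 1`.) If for some `p > 1` and `c > 0` one has
`‖u‖_{L^p(B)} ≤ c (‖𝔸u‖_{L¹(B)} + ‖u‖_{L¹(B)})` for all `u ∈ C^∞(cl B, V)`, then `𝔸`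
is elliptic. -/
theorem statement17 (hn : 1 < n) (A : OpCoeff n 1 V W)
    (h : ∃ p c : ℝ, 1 < p ∧ 0 < c ∧
      ∀ u : Euc n → V, ContDiffOn ℝ (⊤ : ℕ∞) u (closedBall 0 1) →
        (∫ x in ball (0 : Euc n) 1, ‖u x‖ ^ p) ^ (1 / p)
          ≤ c * ((∫ x in ball (0 : Euc n) 1, ‖opApply A u x‖)
              + ∫ x in ball (0 : Euc n) 1, ‖u x‖)) :
    IsElliptic A := by
  obtain ⟨p, c, hp, hc, h⟩ := h
  intro ξ hξ v₁ v₂ hv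
  by_contra hne
  have hv0 : v₁ - v₂ ≠ 0 := sub_ne_zero.mpr hne
  have hsub : symTensor n 1 ξ (v₁ - v₂) = symTensor n 1 ξ v₁ - symTensor n 1 ξ v₂ := by
    ext m
    simp [symTensor, smul_sub]
  have hs : symbol A ξ (v₁ - v₂) = 0 := by
    unfold symbol at hv ⊢
    rw [hsub, map_sub, hv, sub_self]
  have hb := fun k : ℕ => s17_bound A ξ (v₁ - v₂) hv0 hs p c hp h hc (1 / ((k : ℝ) + 1))
    Nat.one_div_pos_of_nat
  have hq : 0 < 1 / p.conjExponent :=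
    one_div_pos.mpr (Real.HolderConjugate.conjExponent hp).symm.pos
  have hT := ((s17_measure_tendsto hn ξ hξ).rpow_const (p := 1 / p.conjExponent)
    (Or.inr hq.le)).const_mul c
  rw [Real.zero_rpow hq.ne', mul_zero] at hT
  have := ge_of_tendsto' hT hb
  linarith
end
end

section
/- Let n>1 and let 𝔸 be a first-order (k=1) elliptic homogeneous linear constant-coefficient differential operator on ℝⁿ from V to W. Then for each 1 ≤ p < n/(n−1) there exists a constant c > 0 such that ‖u‖_{L^p(B)} ≤ c ‖𝔸u‖_{L¹(B)} for all u ∈ C_c^∞(B, V). -/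
noncomputable section

open MeasureTheory Metric
open scoped ENNReal RealInnerProductSpace

variable {n k : ℕ} {V W : Type*}
  [NormedAddCommGroup V] [InnerProductSpace ℝ V] [FiniteDimensional ℝ V]
  [NormedAddCommGroup W] [InnerProductSpace ℝ W] [FiniteDimensional ℝ W]

set_option linter.all false
set_option linter.unusedSectionVars false
set_option linter.deprecated false

open scoped FourierTransform SchwartzMap LineDeriv

/-- The coefficient maps. -/
def coeffMap (A : OpCoeff n 1 V W) (i : Fin n) : V →L[ℝ] W :=
  LinearMap.toContinuousLinearMap
    { toFun := fun v => symbol A (EuclideanSpace.single i 1) v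
      map_add' := by
        intro v w
        unfold symbol
        rw [← map_add]
        congr 1
        ext m
        simp [symTensor]
      map_smul' := by
        intro c v
        unfold symbol
        rw [RingHom.id_apply, ← map_smul]
        congr 1
        ext m
        simp [symTensor, smul_comm c] }

lemma coeffMap_apply (A : OpCoeff n 1 V W) (i : Fin n) (v : V) :
    coeffMap A i v = symbol A (EuclideanSpace.single i 1) v := rfl

lemma symbol_eq_sum (A : OpCoeff n 1 V W) (ξ : Euc n) (v : V) :
    symbol A ξ v = ∑ i, ξ i • coeffMap A i v := by
  simp only [coeffMap_apply, symbol]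
  simp_rw [← map_smul]
  rw [← map_sum]
  congr 1
  ext m
  simp only [symTensor, ContinuousMultilinearMap.compContinuousLinearMap_apply,
    ContinuousMultilinearMap.mkPiRing_apply, ContinuousMultilinearMap.sum_apply,
    ContinuousMultilinearMap.smul_apply, Fin.prod_univ_one, innerSL_apply_apply]
  simp_rw [smul_smul]
  rw [← Finset.sum_smul]
  congr 1
  simp [PiLp.inner_apply, EuclideanSpace.inner_single_left, mul_comm]

lemma opApply_eq_sum (A : OpCoeff n 1 V W) (u : Euc n → V) (x : Euc n) :
    opApply A u x = ∑ i, coeffMap A i (fderiv ℝ u x (EuclideanSpace.single i 1)) := by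
  simp only [coeffMap_apply, symbol, opApply]
  rw [← map_sum]
  congr 1
  ext m
  simp only [symTensor, ContinuousMultilinearMap.compContinuousLinearMap_apply,
    ContinuousMultilinearMap.mkPiRing_apply, ContinuousMultilinearMap.sum_apply,
    Fin.prod_univ_one, innerSL_apply_apply, iteratedFDeriv_one_apply]
  simp_rw [← map_smul]
  rw [← map_sum]
  congr 1
  ext j
  simp [EuclideanSpace.inner_single_left, Pi.single_apply]

lemma multiplier_exists (a : Fin n → V →L[ℝ] W)
    (ha : ∀ ξ : Euc n, ξ ≠ 0 → Function.Injective (∑ i, ξ i • a i : V →L[ℝ] W))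
    (l : V →L[ℝ] ℝ) (φ : Euc n → ℝ) (hφ : ContDiff ℝ (⊤ : ℕ∞) φ) (hφc : HasCompactSupport φ)
    (hφ0 : ∀ ξ ∈ ball (0 : Euc n) 1, φ ξ = 0) :
    ∃ m : 𝓢(Euc n, W →L[ℝ] ℂ), ∀ ξ v,
      (2 * Real.pi * Complex.I) * ∑ i, (ξ i : ℂ) * m ξ (a i v) = φ ξ * l v := by
  classical
  haveI : CompleteSpace V := FiniteDimensional.complete ℝ V
  haveI : CompleteSpace W := FiniteDimensional.complete ℝ W
  set S : Euc n → V →L[ℝ] W := fun ξ => ∑ i, ξ i • a i with hS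
  set T : Euc n → W →L[ℝ] V := fun ξ => ∑ i, ξ i • ContinuousLinearMap.adjoint (a i) with hT
  have hTS : ∀ ξ, T ξ = ContinuousLinearMap.adjoint (S ξ) := by
    intro ξ; simp [hT, hS, map_sum]
  have hunit : ∀ ξ, ξ ≠ 0 → IsUnit ((T ξ).comp (S ξ)) := by
    intro ξ hξ
    rw [ContinuousLinearMap.isUnit_iff_bijective]
    have hinj : Function.Injective ((T ξ).comp (S ξ)) := by
      rw [injective_iff_map_eq_zero]
      intro v hv
      rw [hTS] at hv
      have h1 : inner ℝ (S ξ v) (S ξ v) = 0 := by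
        rw [← ContinuousLinearMap.adjoint_inner_left]
        simp only [ContinuousLinearMap.comp_apply] at hv
        rw [hv, inner_zero_left]
      have h2 := inner_self_eq_zero.1 h1
      exact (injective_iff_map_eq_zero _).1 (ha ξ hξ) v h2
    exact ⟨hinj, LinearMap.surjective_of_injective (f := ((T ξ).comp (S ξ)).toLinearMap) hinj⟩
  have hSc : ContDiff ℝ (⊤ : ℕ∞) S := by
    apply ContDiff.sum; intro i _
    exact ContDiff.smul (f := fun ξ : Euc n => ξ i) (by fun_prop) contDiff_const
  have hTc : ContDiff ℝ (⊤ : ℕ∞) T := by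
    apply ContDiff.sum; intro i _
    exact ContDiff.smul (f := fun ξ : Euc n => ξ i) (by fun_prop) contDiff_const
  obtain ⟨L, hL⟩ : ∃ L : V →L[ℝ] ℂ, ∀ v, L v = (2 * Real.pi * Complex.I)⁻¹ * l v :=
    ⟨((2 * Real.pi * Complex.I)⁻¹ : ℂ) • Complex.ofRealCLM.comp l, fun v => by simp⟩
  set m0 : Euc n → W →L[ℝ] ℂ := fun ξ => (φ ξ) •
    L.comp ((Ring.inverse ((T ξ).comp (S ξ))).comp (T ξ)) with hm0
  have hz : ∀ ξ, φ ξ = 0 → m0 ξ = 0 := by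
    intro ξ h
    ext w
    simp only [hm0, h, ContinuousLinearMap.smul_apply, ContinuousLinearMap.zero_apply]
    exact zero_smul ℝ (_ : ℂ)
  have hm0c : ContDiff ℝ (⊤ : ℕ∞) m0 := by
    rw [contDiff_iff_contDiffAt]
    intro ξ
    by_cases hξ : ξ = 0
    · have : m0 =ᶠ[nhds ξ] fun _ => 0 := by
        filter_upwards [isOpen_ball.mem_nhds (show ξ ∈ ball (0 : Euc n) 1 by simp [hξ])] with y hy
        exact hz y (hφ0 y hy)
      exact contDiffAt_const.congr_of_eventuallyEq this
    · obtain ⟨w, hw⟩ := hunit ξ hξ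
      apply hφ.contDiffAt.smul
      apply ContDiffAt.clm_comp contDiffAt_const
      apply ContDiffAt.clm_comp _ hTc.contDiffAt
      have h1 : ContDiffAt ℝ (⊤ : ℕ∞) (Ring.inverse : (V →L[ℝ] V) → _) ((T ξ).comp (S ξ)) := by
        rw [← hw]; exact contDiffAt_ringInverse ℝ w
      exact h1.comp ξ (hTc.contDiffAt.clm_comp hSc.contDiffAt)
  have hm0s : HasCompactSupport m0 := by
    apply hφc.mono
    intro ξ hξ h0
    apply hξ
    exact hz ξ h0
  refine ⟨hm0s.toSchwartzMap hm0c, ?_⟩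
  intro ξ v
  have hc : ∀ ξ, (hm0s.toSchwartzMap hm0c) ξ = m0 ξ := fun _ => rfl
  rw [hc]
  have h1 : ∑ i, (ξ i : ℂ) * m0 ξ (a i v) = m0 ξ (S ξ v) := by
    simp only [hS, ContinuousLinearMap.sum_apply, map_sum, ContinuousLinearMap.smul_apply, map_smul]
    simp
  rw [h1]
  by_cases hξ : ξ = 0
  · have h3 : φ ξ = 0 := by rw [hξ]; exact hφ0 0 (by simp)
    have h4 : m0 ξ = 0 := hz ξ h3
    rw [h4, h3]; simp
  · have h2 : (Ring.inverse ((T ξ).comp (S ξ))) (T ξ (S ξ v)) = v := by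
      have := Ring.inverse_mul_cancel _ (hunit ξ hξ)
      exact congrArg (fun L : V →L[ℝ] V => L v) this
    have h3 : m0 ξ (S ξ v) = φ ξ * ((2 * Real.pi * Complex.I)⁻¹ * l v) := by
      simp only [hm0, ContinuousLinearMap.smul_apply, ContinuousLinearMap.comp_apply, h2, hL]
      exact Complex.real_smul
    rw [h3]
    have : (2 * Real.pi * Complex.I : ℂ) ≠ 0 := by simp [Real.pi_ne_zero]
    field_simp
lemma integrable_exp_smul {F : Type*} [NormedAddCommGroup F] [NormedSpace ℝ F] [NormedSpace ℂ F]
    (g : 𝓢(Euc n, F)) (z : Euc n) :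
    Integrable (fun ξ : Euc n =>
      Complex.exp (((2 * Real.pi * inner ℝ ξ z : ℝ)) * Complex.I) • g ξ) := by
  refine Integrable.mono g.integrable ?_ ?_
  · apply Continuous.aestronglyMeasurable
    have := g.continuous
    fun_prop
  · refine Filter.Eventually.of_forall fun ξ => ?_
    rw [norm_smul, Complex.norm_exp_ofReal_mul_I, one_mul]

lemma kernel_exists (a : Fin n → V →L[ℝ] W)
    (ha : ∀ ξ : Euc n, ξ ≠ 0 → Function.Injective (∑ i, ξ i • a i : V →L[ℝ] W)) :
    ∃ η : 𝓢(Euc n, ℂ), (∫ z, η z = 1) ∧ ∀ l : V →L[ℝ] ℝ, ∃ K : 𝓢(Euc n, W →L[ℝ] ℂ),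
      ∀ z v, ∑ i, (fderiv ℝ K z (EuclideanSpace.single i 1)) (a i v)
        = (2 ^ n * η ((2 : ℝ) • z) - η z) * l v := by
  classical
  let χ : ContDiffBump (0 : Euc n) := ⟨1, 2, by norm_num, by norm_num⟩
  have hχc : HasCompactSupport (fun x => (χ x : ℂ)) :=
    χ.hasCompactSupport.comp_left (g := fun r : ℝ => (r : ℂ)) (by simp)
  have hχs : ContDiff ℝ (⊤ : ℕ∞) (fun x => (χ x : ℂ)) :=
    Complex.ofRealCLM.contDiff.comp χ.contDiff
  set X : 𝓢(Euc n, ℂ) := hχc.toSchwartzMap hχs with hX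
  have hXa : ∀ ξ, X ξ = (χ ξ : ℂ) := fun _ => rfl
  set η : 𝓢(Euc n, ℂ) := 𝓕⁻ X with hη
  have hηa : ∀ z, η z = ∫ ξ, Complex.exp (((2 * Real.pi * inner ℝ ξ z : ℝ)) * Complex.I) * (χ ξ : ℂ) := by
    intro z
    rw [hη, SchwartzMap.fourierInv_coe, Real.fourierInv_eq']
    rfl
  refine ⟨η, ?_, ?_⟩
  · have h1 : 𝓕 η = X := FourierTransform.fourier_fourierInv_eq X
    have h2 : (𝓕 η) 0 = ∫ z, η z := by
      rw [SchwartzMap.fourier_coe, Real.fourier_eq']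
      simp
    rw [← h2, h1, hXa]
    have : χ 0 = 1 := χ.one_of_mem_closedBall (by simp [χ])
    simp [this]
  intro l
  set φ : Euc n → ℝ := fun ξ => χ ((1 / 2 : ℝ) • ξ) - χ ξ with hφ
  have hc2 : HasCompactSupport (fun ξ : Euc n => χ ((1 / 2 : ℝ) • ξ)) :=
    χ.hasCompactSupport.comp_homeomorph (Homeomorph.smulOfNeZero (1 / 2 : ℝ) (by norm_num))
  have hs2 : ContDiff ℝ (⊤ : ℕ∞) (fun ξ : Euc n => χ ((1 / 2 : ℝ) • ξ)) :=
    χ.contDiff.comp (contDiff_const_smul _)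
  have hφs : ContDiff ℝ (⊤ : ℕ∞) φ := hs2.sub χ.contDiff
  have hφc : HasCompactSupport φ := hc2.sub χ.hasCompactSupport
  have hφ0 : ∀ ξ ∈ ball (0 : Euc n) 1, φ ξ = 0 := by
    intro ξ hξ
    rw [mem_ball_zero_iff] at hξ
    have h1 : χ ξ = 1 := χ.one_of_mem_closedBall (by
      rw [mem_closedBall_zero_iff]; exact hξ.le)
    have h2 : χ ((1 / 2 : ℝ) • ξ) = 1 := χ.one_of_mem_closedBall (by
      rw [mem_closedBall_zero_iff, norm_smul]
      show _ ≤ (1 : ℝ)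
      norm_num
      linarith [norm_nonneg ξ])
    simp only [hφ, h1, h2, sub_self]
  obtain ⟨m, hm⟩ := multiplier_exists a ha l φ hφs hφc hφ0
  refine ⟨𝓕⁻ m, ?_⟩
  intro z v
  have hgi : ∀ i : Fin n, ∀ w, (fderiv ℝ (𝓕⁻ m : 𝓢(Euc n, W →L[ℝ] ℂ)) z (EuclideanSpace.single i 1)) w =
      ∫ ξ, Complex.exp (((2 * Real.pi * inner ℝ ξ z : ℝ)) * Complex.I) *
        ((2 * Real.pi * Complex.I) * ((ξ i : ℂ) * m ξ w)) := by
    intro i w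
    have h1 := SchwartzMap.lineDerivOp_fourierInv_eq m (EuclideanSpace.single i (1 : ℝ))
    rw [← SchwartzMap.lineDerivOp_apply_eq_fderiv, h1, SchwartzMap.fourierInv_coe,
      Real.fourierInv_eq', ContinuousLinearMap.integral_apply (integrable_exp_smul _ z)]
    apply integral_congr_ae
    refine Filter.Eventually.of_forall fun ξ => ?_
    have h2 : (fun x : Euc n => inner ℝ x (EuclideanSpace.single i (1 : ℝ))).HasTemperateGrowth := by
      fun_prop
    have h3 : ((2 * Real.pi * Complex.I) • SchwartzMap.smulLeftCLM (W →L[ℝ] ℂ)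
        (fun x : Euc n => inner ℝ x (EuclideanSpace.single i (1 : ℝ))) m) ξ
        = (2 * Real.pi * Complex.I) • ((ξ i) • m ξ) := by
      rw [SchwartzMap.smul_apply, SchwartzMap.smulLeftCLM_apply_apply h2]
      simp [EuclideanSpace.inner_single_right]
    beta_reduce
    rw [h3]
    simp
  have hgint : ∀ i : Fin n, ∀ w, Integrable (fun ξ : Euc n =>
      Complex.exp (((2 * Real.pi * inner ℝ ξ z : ℝ)) * Complex.I) *
        ((2 * Real.pi * Complex.I) * ((ξ i : ℂ) * m ξ w))) := by
    intro i w
    have h2 : (fun x : Euc n => inner ℝ x (EuclideanSpace.single i (1 : ℝ))).HasTemperateGrowth := by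
      fun_prop
    have h3 := (ContinuousLinearMap.apply ℝ ℂ w).integrable_comp (integrable_exp_smul
      ((2 * Real.pi * Complex.I) • SchwartzMap.smulLeftCLM (W →L[ℝ] ℂ)
        (fun x : Euc n => inner ℝ x (EuclideanSpace.single i (1 : ℝ))) m) z)
    refine h3.congr (Filter.Eventually.of_forall fun ξ => ?_)
    have h3 : ((2 * Real.pi * Complex.I) • SchwartzMap.smulLeftCLM (W →L[ℝ] ℂ)
        (fun x : Euc n => inner ℝ x (EuclideanSpace.single i (1 : ℝ))) m) ξ
        = (2 * Real.pi * Complex.I) • ((ξ i) • m ξ) := by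
      rw [SchwartzMap.smul_apply, SchwartzMap.smulLeftCLM_apply_apply h2]
      simp [EuclideanSpace.inner_single_right]
    beta_reduce
    rw [h3]
    simp
  simp_rw [hgi]
  rw [← integral_finset_sum _ (fun i _ => hgint i _)]
  have h4 : ∀ ξ : Euc n, ∑ i, Complex.exp (((2 * Real.pi * inner ℝ ξ z : ℝ)) * Complex.I) *
        ((2 * Real.pi * Complex.I) * ((ξ i : ℂ) * m ξ (a i v)))
      = (Complex.exp (((2 * Real.pi * inner ℝ ξ z : ℝ)) * Complex.I) * (χ ((1 / 2 : ℝ) • ξ) : ℂ)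
        - Complex.exp (((2 * Real.pi * inner ℝ ξ z : ℝ)) * Complex.I) * (χ ξ : ℂ)) * l v := by
    intro ξ
    rw [← Finset.mul_sum, ← Finset.mul_sum, hm ξ v]
    simp only [hφ]
    push_cast
    ring
  simp_rw [h4]
  rw [integral_mul_const]
  congr 1
  have hi1 : Integrable (fun ξ : Euc n =>
      Complex.exp (((2 * Real.pi * inner ℝ ξ z : ℝ)) * Complex.I) * (χ ξ : ℂ)) :=
    integrable_exp_smul X z
  have hF : ∀ ξ : Euc n, Complex.exp (((2 * Real.pi * inner ℝ ξ z : ℝ)) * Complex.I)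
      * (χ ((1 / 2 : ℝ) • ξ) : ℂ) = (fun ξ : Euc n =>
        Complex.exp (((2 * Real.pi * inner ℝ ξ ((2 : ℝ) • z) : ℝ)) * Complex.I) * (χ ξ : ℂ))
          ((1 / 2 : ℝ) • ξ) := by
    intro ξ
    have : inner ℝ ((1 / 2 : ℝ) • ξ) ((2 : ℝ) • z) = inner ℝ ξ z := by
      rw [real_inner_smul_left, real_inner_smul_right]; ring
    simp only [this]
  have hi2 : Integrable (fun ξ : Euc n =>
      Complex.exp (((2 * Real.pi * inner ℝ ξ z : ℝ)) * Complex.I) * (χ ((1 / 2 : ℝ) • ξ) : ℂ)) := by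
    simp_rw [hF]
    exact (integrable_exp_smul X ((2 : ℝ) • z)).comp_smul (by norm_num)
  rw [integral_sub hi2 hi1, ← hηa z]
  congr 1
  rw [integral_congr_ae (ae_of_all _ hF)]
  refine (Measure.integral_comp_smul (volume : Measure (Euc n)) (fun ξ : Euc n =>
        Complex.exp (((2 * Real.pi * inner ℝ ξ ((2 : ℝ) • z) : ℝ)) * Complex.I) * (χ ξ : ℂ)) (1 / 2 : ℝ)).trans ?_
  rw [← hηa]
  simp
lemma ibp_identity (a : Fin n → V →L[ℝ] W) (η : 𝓢(Euc n, ℂ)) (l : V →L[ℝ] ℝ)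
    (K : 𝓢(Euc n, W →L[ℝ] ℂ))
    (hK : ∀ z v, ∑ i, (fderiv ℝ K z (EuclideanSpace.single i 1)) (a i v)
        = (2 ^ n * η ((2 : ℝ) • z) - η z) * l v)
    (v : Euc n → V) (hv : ContDiff ℝ (⊤ : ℕ∞) v) (hvc : HasCompactSupport v) :
    ∫ z, K z (∑ i, a i (fderiv ℝ v z (EuclideanSpace.single i 1)))
      = (∫ z, η z * l (v z)) - ∫ z, η z * l (v ((1 / 2 : ℝ) • z)) := by
  have hvd : Differentiable ℝ v := hv.differentiable (by simp)
  have hv' : Continuous (fderiv ℝ v) := hv.continuous_fderiv (by simp)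
  have hKc : Continuous K := K.continuous
  have hKd : Differentiable ℝ K := K.differentiable
  have hK' : Continuous (fderiv ℝ K) := (K.smooth 1).continuous_fderiv (by simp)
  have hvcont : Continuous v := hv.continuous
  have hv'c : HasCompactSupport (fderiv ℝ v) := hvc.fderiv ℝ
  have i1 : ∀ i, Integrable (fun z => K z (a i (fderiv ℝ v z (EuclideanSpace.single i 1)))) := by
    intro i
    apply Continuous.integrable_of_hasCompactSupport (by fun_prop)
    apply hv'c.mono
    intro z hz h0
    apply hz
    simp [show fderiv ℝ v z = 0 from h0]
  have i2 : ∀ i, Integrable (fun z => (fderiv ℝ K z (EuclideanSpace.single i 1)) (a i (v z))) := by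
    intro i
    apply Continuous.integrable_of_hasCompactSupport (by fun_prop)
    apply hvc.mono
    intro z hz h0
    apply hz
    simp [show v z = 0 from h0]
  have i3 : ∀ i, Integrable (fun z => K z (a i (v z))) := by
    intro i
    apply Continuous.integrable_of_hasCompactSupport (by fun_prop)
    apply hvc.mono
    intro z hz h0
    apply hz
    simp [show v z = 0 from h0]
  have hfd : ∀ i z, fderiv ℝ (fun z => a i (v z)) z = (a i).comp (fderiv ℝ v z) := by
    intro i z
    exact ((a i).hasFDerivAt.comp z (hvd z).hasFDerivAt).fderiv
  have key : ∀ i, ∫ z, K z (a i (fderiv ℝ v z (EuclideanSpace.single i 1)))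
      = - ∫ z, (fderiv ℝ K z (EuclideanSpace.single i 1)) (a i (v z)) := by
    intro i
    have := integral_bilinear_fderiv_right_eq_neg_left_of_integrable (μ := volume)
      (f := (K : Euc n → W →L[ℝ] ℂ)) (g := fun z => a i (v z)) (v := EuclideanSpace.single i (1 : ℝ))
      (B := ContinuousLinearMap.id ℝ (W →L[ℝ] ℂ)) (i2 i) (by simpa [hfd] using i1 i) (i3 i)
      (fun z _ => hKd z) (fun z _ => ((a i).hasFDerivAt.comp z (hvd z).hasFDerivAt).differentiableAt)
    simpa [hfd] using this
  simp_rw [map_sum]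
  rw [integral_finset_sum _ (fun i _ => i1 i)]
  simp_rw [key]
  rw [Finset.sum_neg_distrib, ← integral_finset_sum _ (fun i _ => i2 i)]
  simp_rw [hK, sub_mul]
  have hηc : Continuous η := η.continuous
  have hlc : Continuous l := l.continuous
  have j1 : Integrable (fun z => 2 ^ n * η ((2 : ℝ) • z) * (l (v z) : ℂ)) := by
    apply Continuous.integrable_of_hasCompactSupport (by fun_prop)
    apply hvc.mono
    intro z hz h0
    apply hz
    simp [show v z = 0 from h0]
  have j2 : Integrable (fun z => η z * (l (v z) : ℂ)) := by
    apply Continuous.integrable_of_hasCompactSupport (by fun_prop)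
    apply hvc.mono
    intro z hz h0
    apply hz
    simp [show v z = 0 from h0]
  rw [integral_sub j1 j2, neg_sub]
  congr 1
  have h5 : ∀ z, 2 ^ n * η ((2 : ℝ) • z) * (l (v z) : ℂ)
      = (fun z => 2 ^ n * (η z * (l (v ((1 / 2 : ℝ) • z)) : ℂ))) ((2 : ℝ) • z) := by
    intro z
    simp only [smul_smul]
    norm_num
    ring
  rw [integral_congr_ae (ae_of_all _ h5)]
  refine (Measure.integral_comp_smul (volume : Measure (Euc n))
    (fun z => 2 ^ n * (η z * (l (v ((1 / 2 : ℝ) • z)) : ℂ))) (2 : ℝ)).trans ?_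
  rw [integral_const_mul]
  simp

lemma scale_identity (A : OpCoeff n 1 V W) (η : 𝓢(Euc n, ℂ)) (l : V →L[ℝ] ℝ)
    (K : 𝓢(Euc n, W →L[ℝ] ℂ))
    (hK : ∀ z v, ∑ i, (fderiv ℝ K z (EuclideanSpace.single i 1)) (coeffMap A i v)
        = (2 ^ n * η ((2 : ℝ) • z) - η z) * l v)
    (u : Euc n → V) (hu : ContDiff ℝ (⊤ : ℕ∞) u) (huc : HasCompactSupport u)
    (t : ℝ) (ht : 0 < t) (x : Euc n) :
    (∫ z, η z * l (u (x - (t / 2) • z))) - ∫ z, η z * l (u (x - t • z))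
      = t * ∫ z, K z (opApply A u (x - t • z)) := by
  set v : Euc n → V := fun z => u (x - t • z) with hv
  have hvs : ContDiff ℝ (⊤ : ℕ∞) v := hu.comp (contDiff_const.sub (contDiff_const_smul t))
  have hvc : HasCompactSupport v := by
    have := huc.comp_homeomorph
      ((Homeomorph.smulOfNeZero t ht.ne').trans (Homeomorph.subLeft x))
    exact this
  have h1 := ibp_identity _ η l K hK v hvs hvc
  have h2 : ∀ z, fderiv ℝ v z = (fderiv ℝ u (x - t • z)).comp (-(t • ContinuousLinearMap.id ℝ (Euc n))) := by
    intro z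
    have hd : HasFDerivAt (fun z : Euc n => x - t • z) (-(t • ContinuousLinearMap.id ℝ (Euc n))) z :=
      ((hasFDerivAt_id z).const_smul t).const_sub x
    exact ((hu.differentiable (by simp) (x - t • z)).hasFDerivAt.comp z hd).fderiv
  have h3 : ∀ z, K z (∑ i, coeffMap A i (fderiv ℝ v z (EuclideanSpace.single i 1)))
      = -((t : ℂ) * K z (opApply A u (x - t • z))) := by
    intro z
    rw [opApply_eq_sum]
    have : ∑ i, coeffMap A i (fderiv ℝ v z (EuclideanSpace.single i 1)) = (-t) •
        ∑ i, coeffMap A i (fderiv ℝ u (x - t • z) (EuclideanSpace.single i 1)) := by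
      rw [Finset.smul_sum]
      refine Finset.sum_congr rfl fun i _ => ?_
      rw [h2, ← map_smul]
      simp
    rw [this, map_smul]
    simp
  simp_rw [h3] at h1
  rw [integral_neg, integral_const_mul] at h1
  simp only [hv, smul_smul] at h1
  have h4 : t * (1 / 2) = t / 2 := by ring
  rw [h4] at h1
  linear_combination h1
lemma jensen_lintegral {α : Type*} [MeasurableSpace α] (μ : Measure α) (k F : α → ℝ≥0∞)
    (hk : Measurable k) (hF : Measurable F) (p : ℝ) (hp : 1 ≤ p) :
    ∫⁻ z, k z * F z ∂μ ≤ (∫⁻ z, k z ^ p * F z ∂μ) ^ (1 / p) * (∫⁻ z, F z ∂μ) ^ (1 - 1 / p) := by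
  have h := eLpNorm'_le_eLpNorm'_mul_rpow_measure_univ (μ := μ.withDensity F) (f := k)
    (p := 1) (q := p) one_pos hp hk.aestronglyMeasurable
  simp only [eLpNorm'_eq_lintegral_enorm, enorm_eq_self, ENNReal.rpow_one, div_one] at h
  rw [lintegral_withDensity_eq_lintegral_mul _ hF hk,
    lintegral_withDensity_eq_lintegral_mul _ hF (hk.pow_const p),
    withDensity_apply _ MeasurableSet.univ, Measure.restrict_univ] at h
  simpa [mul_comm] using h

lemma lintegral_sub_smul (F : Euc n → ℝ≥0∞) (hF : Measurable F) (x : Euc n) (t : ℝ) (ht : 0 < t) :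
    ∫⁻ z, F (x - t • z) = ENNReal.ofReal (t ^ (-(n : ℝ))) * ∫⁻ z, F z := by
  have h1 : ∫⁻ z, F (x - t • z) = ∫⁻ y, F (x - y) ∂(Measure.map (fun z : Euc n => t • z) volume) := by
    rw [lintegral_map (by fun_prop) (by fun_prop)]
  rw [h1, Measure.map_addHaar_smul _ ht.ne', lintegral_smul_measure, lintegral_sub_left_eq_self]
  simp only [finrank_euclideanSpace, Fintype.card_fin, smul_eq_mul]
  rw [abs_of_nonneg (by positivity), Real.rpow_neg ht.le, Real.rpow_natCast]

lemma conv_bound (K : 𝓢(Euc n, W →L[ℝ] ℂ)) (f : Euc n → W) (hf : Continuous f)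
    (p : ℝ) (hp : 1 ≤ p) (t : ℝ) (ht : 0 < t) :
    eLpNorm (fun x => (t : ℂ) * ∫ z, K z (f (x - t • z))) (ENNReal.ofReal p) volume
      ≤ ENNReal.ofReal (t ^ (1 - n * (1 - 1 / p))) * eLpNorm K (ENNReal.ofReal p) volume
        * ∫⁻ z, ‖f z‖ₑ := by
  have hp0 : 0 < p := by linarith
  have hKc : Continuous K := K.continuous
  have hfm : StronglyMeasurable f := hf.stronglyMeasurable
  have e0 : ENNReal.ofReal p ≠ 0 := by simpa using hp0
  have e1 : (ENNReal.ofReal p).toReal = p := ENNReal.toReal_ofReal hp0.le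
  rw [eLpNorm_eq_lintegral_rpow_enorm_toReal e0 ENNReal.ofReal_ne_top,
    eLpNorm_eq_lintegral_rpow_enorm_toReal e0 ENNReal.ofReal_ne_top, e1]
  set N := ∫⁻ z, ‖f z‖ₑ with hN
  set M := ENNReal.ofReal (t ^ (-(n : ℝ))) * N with hM
  set H : Euc n → ℝ≥0∞ := fun x => ∫⁻ z, ‖K z‖ₑ ^ p * ‖f (x - t • z)‖ₑ with hH
  have hpt : ∀ x, ‖(t : ℂ) * ∫ z, K z (f (x - t • z))‖ₑ
      ≤ ENNReal.ofReal t * M ^ (1 - 1 / p) * H x ^ (1 / p) := by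
    intro x
    rw [enorm_mul]
    have h1 : ‖(t : ℂ)‖ₑ = ENNReal.ofReal t := by
      rw [← ofReal_norm_eq_enorm, Complex.norm_real, Real.norm_of_nonneg ht.le]
    rw [h1, mul_assoc]
    gcongr
    calc ‖∫ z, K z (f (x - t • z))‖ₑ ≤ ∫⁻ z, ‖K z (f (x - t • z))‖ₑ :=
          enorm_integral_le_lintegral_enorm _
      _ ≤ ∫⁻ z, ‖K z‖ₑ * ‖f (x - t • z)‖ₑ := lintegral_mono fun z => (K z).le_opENorm _
      _ ≤ _ := jensen_lintegral _ _ _ (by fun_prop) (by fun_prop) p hp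
      _ = M ^ (1 - 1 / p) * H x ^ (1 / p) := by
          rw [lintegral_sub_smul (fun y => ‖f y‖ₑ) (by fun_prop) x t ht, mul_comm]
  have hHi : ∫⁻ x, H x = (∫⁻ z, ‖K z‖ₑ ^ p) * N := by
    simp only [hH]
    rw [lintegral_lintegral_swap]
    · rw [← lintegral_mul_const _ (by fun_prop)]
      refine lintegral_congr fun z => ?_
      rw [lintegral_const_mul _ (by fun_prop)]
      congr 1
      exact lintegral_sub_right_eq_self (fun y => ‖f y‖ₑ) (t • z)
    · apply Measurable.aemeasurable
      simp only [Function.uncurry_def]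
      fun_prop
  have hHm : Measurable H := by
    apply Measurable.lintegral_prod_right' (f := fun q : Euc n × Euc n => ‖K q.2‖ₑ ^ p * ‖f (q.1 - t • q.2)‖ₑ)
    fun_prop
  calc (∫⁻ x, ‖(t : ℂ) * ∫ z, K z (f (x - t • z))‖ₑ ^ p) ^ (1 / p)
      ≤ (∫⁻ x, (ENNReal.ofReal t * M ^ (1 - 1 / p) * H x ^ (1 / p)) ^ p) ^ (1 / p) := by
        gcongr with x
        exact hpt x
    _ = (∫⁻ x, (ENNReal.ofReal t * M ^ (1 - 1 / p)) ^ p * H x) ^ (1 / p) := by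
        congr 1
        refine lintegral_congr fun x => ?_
        rw [ENNReal.mul_rpow_of_nonneg _ _ hp0.le, ← ENNReal.rpow_mul (H x), one_div_mul_cancel hp0.ne',
          ENNReal.rpow_one]
    _ = (ENNReal.ofReal t * M ^ (1 - 1 / p)) * ((∫⁻ z, ‖K z‖ₑ ^ p) * N) ^ (1 / p) := by
        rw [lintegral_const_mul _ hHm, hHi, ENNReal.mul_rpow_of_nonneg _ _ (by positivity),
          ← ENNReal.rpow_mul, mul_one_div_cancel hp0.ne', ENNReal.rpow_one]
    _ = _ := by
        have hq : 0 ≤ 1 - 1 / p := by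
          rw [sub_nonneg, div_le_one hp0]; exact hp
        have hN2 : N ^ (1 - 1 / p) * N ^ (1 / p) = N := by
          rw [← ENNReal.rpow_add_of_nonneg _ _ hq (by positivity)]
          simp
        rw [hM, ENNReal.mul_rpow_of_nonneg _ N hq, ENNReal.mul_rpow_of_nonneg _ N (z := 1 / p) (by positivity),
          
          ENNReal.ofReal_rpow_of_nonneg (by positivity) hq, ← Real.rpow_mul ht.le]
        have h3 : t ^ (1 - n * (1 - 1 / p)) = t * t ^ (-(n : ℝ) * (1 - 1 / p)) := by
          rw [sub_eq_add_neg, Real.rpow_add ht, Real.rpow_one, neg_mul]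
        rw [h3, ENNReal.ofReal_mul ht.le]
        conv_rhs => rw [← hN2]
        ring
open Filter Topology in
lemma component_bound (hn : 1 < n) (A : OpCoeff n 1 V W) (η : 𝓢(Euc n, ℂ)) (l : V →L[ℝ] ℝ)
    (K : 𝓢(Euc n, W →L[ℝ] ℂ)) (hη1 : ∫ z, η z = 1)
    (hK : ∀ z v, ∑ i, (fderiv ℝ K z (EuclideanSpace.single i 1)) (coeffMap A i v)
        = (2 ^ n * η ((2 : ℝ) • z) - η z) * l v)
    (p : ℝ) (hp1 : 1 ≤ p) (hp2 : p < (n : ℝ) / (n - 1)) (ε : ℝ≥0∞) (hε : 0 < ε) :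
    ∃ C : ℝ≥0∞, C ≠ ⊤ ∧ ∀ u : Euc n → V, ContDiff ℝ (⊤ : ℕ∞) u → HasCompactSupport u →
      tsupport u ⊆ ball (0 : Euc n) 1 →
      eLpNorm (fun x => (l (u x) : ℂ)) (ENNReal.ofReal p) (volume.restrict (ball 0 1))
        ≤ ε * eLpNorm u (ENNReal.ofReal p) (volume.restrict (ball 0 1))
          + C * ∫⁻ z, ‖opApply A u z‖ₑ := by
  have hp0 : 0 < p := by linarith
  set P := ENNReal.ofReal p with hP
  set μ : Measure (Euc n) := volume.restrict (ball 0 1) with hμ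
  have e1 : P.toReal = p := ENNReal.toReal_ofReal hp0.le
  have hP1 : 1 ≤ P := by rw [hP, ← ENNReal.ofReal_one]; exact ENNReal.ofReal_le_ofReal hp1
  have hnR : (1 : ℝ) < n := by exact_mod_cast hn
  have hμf : IsFiniteMeasure μ := by
    refine ⟨?_⟩
    rw [hμ, Measure.restrict_apply_univ]
    exact measure_ball_lt_top
  have hμu : μ Set.univ ≠ ⊤ := measure_ne_top _ _
  have hηc : Continuous η := η.continuous
  have hlc : Continuous l := l.continuous
  -- exponent
  set α : ℝ := 1 - n * (1 - 1 / p) with hα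
  have hαpos : 0 < α := by
    rw [lt_div_iff₀ (by linarith)] at hp2
    have : α = (n - p * (n - 1)) / p := by rw [hα]; field_simp; ring
    rw [this]
    apply div_pos _ hp0
    linarith
  -- bound for η
  obtain ⟨Sη, hSη⟩ : ∃ S : ℝ, ∀ z, ‖η z‖ ≤ S := ⟨_, fun z => SchwartzMap.norm_le_seminorm ℝ η z⟩
  set C0 : ℝ≥0∞ := μ Set.univ ^ (1 / p) * (ENNReal.ofReal Sη * ‖l‖ₑ * μ Set.univ ^ (1 - 1 / p)) with hC0
  have hq : 0 ≤ 1 - 1 / p := by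
    rw [sub_nonneg, div_le_one hp0]; exact hp1
  have hC0t : C0 ≠ ⊤ := by
    rw [hC0]
    refine ENNReal.mul_ne_top (ENNReal.rpow_ne_top_of_nonneg (by positivity) hμu)
      (ENNReal.mul_ne_top (ENNReal.mul_ne_top ENNReal.ofReal_ne_top enorm_ne_top)
        (ENNReal.rpow_ne_top_of_nonneg hq hμu))
  obtain ⟨R, hR0, hR⟩ : ∃ R : ℝ, 0 < R ∧ ENNReal.ofReal (R ^ (-(n : ℝ))) * C0 ≤ ε := by
    have h1 : Tendsto (fun R : ℝ => ENNReal.ofReal (R ^ (-(n : ℝ))) * C0) atTop (𝓝 (ENNReal.ofReal 0 * C0)) := by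
      apply ENNReal.Tendsto.mul_const _ (Or.inr hC0t)
      exact ENNReal.tendsto_ofReal (tendsto_rpow_neg_atTop (by linarith))
    rw [ENNReal.ofReal_zero, zero_mul] at h1
    obtain ⟨R, h2, h3⟩ := ((h1.eventually (gt_mem_nhds hε)).and (eventually_gt_atTop 0)).exists
    exact ⟨R, h3, h2.le⟩
  set τ : ℕ → ℝ := fun j => R * (1 / 2) ^ j with hτ
  have hτ0 : ∀ j, 0 < τ j := fun j => by positivity
  have hτs : ∀ j, τ (j + 1) = τ j / 2 := fun j => by simp only [hτ, pow_succ]; ring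
  have hsum : Summable (fun j => τ j ^ α) := by
    have : ∀ j, τ j ^ α = R ^ α * ((1 / 2 : ℝ) ^ α) ^ j := by
      intro j
      simp only [hτ]
      rw [Real.mul_rpow hR0.le (by positivity), ← Real.rpow_natCast, ← Real.rpow_natCast,
        ← Real.rpow_mul (by norm_num), ← Real.rpow_mul (by norm_num), mul_comm α]
    simp_rw [this]
    apply Summable.mul_left
    exact summable_geometric_of_lt_one (by positivity) (Real.rpow_lt_one (by norm_num) (by norm_num) hαpos)
  set eK := eLpNorm K P volume with heK
  have heKt : eK ≠ ⊤ := (K.memLp P volume).2.ne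
  refine ⟨(∑' j, ENNReal.ofReal (τ j ^ α)) * eK, ENNReal.mul_ne_top hsum.tsum_ofReal_ne_top heKt, ?_⟩
  intro u hu huc hus
  have huC : Continuous u := hu.continuous
  set f := opApply A u with hf
  have hfC : Continuous f := by
    have : f = fun x => ∑ i, coeffMap A i (fderiv ℝ u x (EuclideanSpace.single i 1)) := by
      ext x; exact opApply_eq_sum A u x
    rw [this]
    have := hu.continuous_fderiv (by simp)
    fun_prop
  set N := ∫⁻ z, ‖f z‖ₑ with hN
  set Q : ℝ → Euc n → ℂ := fun t x => ∫ z, η z * l (u (x - t • z)) with hQ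
  have hQm : ∀ t, AEStronglyMeasurable (Q t) μ := by
    intro t
    apply StronglyMeasurable.aestronglyMeasurable
    apply StronglyMeasurable.integral_prod_right'
      (f := fun q : Euc n × Euc n => η q.2 * (l (u (q.1 - t • q.2)) : ℂ))
    apply Continuous.stronglyMeasurable
    fun_prop
  -- low frequency bound
  have hlow : ∀ t, 0 < t → eLpNorm (Q t) P μ ≤ ENNReal.ofReal (t ^ (-(n : ℝ))) * C0 * eLpNorm u P μ := by
    intro t ht
    have hu1 : ∫⁻ z, ‖u z‖ₑ ≤ eLpNorm u P μ * μ Set.univ ^ (1 - 1 / p) := by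
      have h1 := eLpNorm_le_eLpNorm_mul_rpow_measure_univ (μ := μ) (f := u) hP1
        huC.aestronglyMeasurable
      rw [e1, ENNReal.toReal_one, div_one, eLpNorm_one_eq_lintegral_enorm] at h1
      refine le_trans (le_of_eq ?_) h1
      rw [hμ, setLIntegral_eq_of_support_subset]
      intro x hx
      apply hus
      apply subset_tsupport u
      rw [Function.mem_support] at hx ⊢
      intro h0
      exact hx (by simp [h0])
    have h2 : ∀ x, ‖Q t x‖ₑ ≤ ENNReal.ofReal Sη * ‖l‖ₑ * (ENNReal.ofReal (t ^ (-(n : ℝ))) *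
        (eLpNorm u P μ * μ Set.univ ^ (1 - 1 / p))) := by
      intro x
      calc ‖Q t x‖ₑ ≤ ∫⁻ z, ‖η z * (l (u (x - t • z)) : ℂ)‖ₑ := enorm_integral_le_lintegral_enorm _
        _ ≤ ∫⁻ z, ENNReal.ofReal Sη * ‖l‖ₑ * ‖u (x - t • z)‖ₑ := by
            refine lintegral_mono fun z => ?_
            rw [enorm_mul, mul_assoc]
            gcongr
            · rw [← ofReal_norm_eq_enorm]
              exact ENNReal.ofReal_le_ofReal (hSη z)
            · rw [← ofReal_norm_eq_enorm, Complex.norm_real, ofReal_norm_eq_enorm]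
              exact l.le_opENorm _
        _ = ENNReal.ofReal Sη * ‖l‖ₑ * (ENNReal.ofReal (t ^ (-(n : ℝ))) * ∫⁻ z, ‖u z‖ₑ) := by
            have hum : StronglyMeasurable u := huC.stronglyMeasurable
            rw [lintegral_const_mul _ (by fun_prop),
              lintegral_sub_smul (fun y => ‖u y‖ₑ) (by fun_prop) x t ht]
        _ ≤ _ := by gcongr
    refine (eLpNorm_le_of_ae_enorm_bound (ae_of_all _ h2)).trans (le_of_eq ?_)
    rw [e1, hC0, smul_eq_mul, one_div]
    ring
  -- scale identity
  have hstep : ∀ j, Q (τ (j + 1)) - Q (τ j) = fun x => (τ j : ℂ) * ∫ z, K z (f (x - τ j • z)) := by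
    intro j
    ext x
    rw [Pi.sub_apply, hτs]
    exact scale_identity A η l K hK u hu huc (τ j) (hτ0 j) x
  have hstepb : ∀ j, eLpNorm (Q (τ (j + 1)) - Q (τ j)) P μ ≤ ENNReal.ofReal (τ j ^ α) * eK * N := by
    intro j
    rw [hstep]
    exact (eLpNorm_mono_measure _ Measure.restrict_le_self).trans
      (conv_bound K f hfC p hp1 (τ j) (hτ0 j))
  have htel : ∀ J, Q (τ J) = Q (τ 0) + ∑ j ∈ Finset.range J, (Q (τ (j + 1)) - Q (τ j)) := by
    intro J
    rw [Finset.sum_range_sub (fun j => Q (τ j))]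
    abel
  have hb : ∀ J, eLpNorm (Q (τ J)) P μ
      ≤ ε * eLpNorm u P μ + (∑' j, ENNReal.ofReal (τ j ^ α)) * eK * N := by
    intro J
    rw [htel J]
    refine (eLpNorm_add_le (hQm _) (Finset.aestronglyMeasurable_sum _
      fun j _ => (hQm _).sub (hQm _)) hP1).trans ?_
    gcongr
    · refine (hlow _ (hτ0 0)).trans ?_
      have : τ 0 = R := by simp [hτ]
      rw [this]
      gcongr
    · refine (eLpNorm_sum_le (fun j _ => (hQm _).sub (hQm _)) hP1).trans ?_
      refine (Finset.sum_le_sum fun j _ => hstepb j).trans ?_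
      rw [← Finset.sum_mul, ← Finset.sum_mul]
      gcongr
      exact ENNReal.sum_le_tsum _
  refine Lp.eLpNorm_le_of_ae_tendsto (u := atTop) (f := fun J => Q (τ J)) (Eventually.of_forall hb)
    (fun J => hQm _) (ae_of_all _ fun x => ?_)
  obtain ⟨Cu, hCu⟩ := huC.bounded_above_of_compact_support huc
  have hτlim : Tendsto τ atTop (𝓝 0) := by
    have := (tendsto_pow_atTop_nhds_zero_of_lt_one (r := (1 / 2 : ℝ)) (by norm_num) (by norm_num)).const_mul R
    simpa [hτ] using this
  have hlim : Tendsto (fun J => ∫ z, η z * (l (u (x - τ J • z)) : ℂ)) atTop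
      (𝓝 (∫ z, η z * (l (u x) : ℂ))) := by
    apply tendsto_integral_of_dominated_convergence (fun z => ‖η z‖ * (‖l‖ * Cu))
    · intro J
      apply Continuous.aestronglyMeasurable
      fun_prop
    · exact η.integrable.norm.mul_const _
    · intro J
      refine ae_of_all _ fun z => ?_
      rw [norm_mul, Complex.norm_real]
      gcongr
      exact (l.le_opNorm _).trans (by gcongr; exact hCu _)
    · refine ae_of_all _ fun z => ?_
      have hc : Continuous (fun t : ℝ => η z * (l (u (x - t • z)) : ℂ)) := by fun_prop
      have := (hc.tendsto 0).comp hτlim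
      simpa [Function.comp_def] using this
  rw [integral_mul_const, hη1, one_mul] at hlim
  exact hlim
/-- (`k = 1`.) If `𝔸` is a first-order elliptic operator, then for each
`1 ≤ p < n/(n-1)` there is `c > 0` with `‖u‖_{L^p(B)} ≤ c ‖𝔸u‖_{L¹(B)}` for all
`u ∈ C_c^∞(B, V)`. -/
theorem statement19 (hn : 1 < n) (A : OpCoeff n 1 V W) (hA : IsElliptic A)
    (p : ℝ) (hp1 : 1 ≤ p) (hp2 : p < (n : ℝ) / (n - 1)) :
    ∃ c : ℝ, 0 < c ∧ ∀ u : Euc n → V, ContDiff ℝ (⊤ : ℕ∞) u → HasCompactSupport u →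
      tsupport u ⊆ ball (0 : Euc n) 1 →
        (∫ x in ball (0 : Euc n) 1, ‖u x‖ ^ p) ^ (1 / p)
          ≤ c * ∫ x in ball (0 : Euc n) 1, ‖opApply A u x‖ := by
  have hp0 : 0 < p := by linarith
  set P := ENNReal.ofReal p with hP
  set μ : Measure (Euc n) := volume.restrict (ball 0 1) with hμ
  have e1 : P.toReal = p := ENNReal.toReal_ofReal hp0.le
  have hP1 : 1 ≤ P := by rw [hP, ← ENNReal.ofReal_one]; exact ENNReal.ofReal_le_ofReal hp1
  have hP0 : P ≠ 0 := by
    intro h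
    rw [h] at hP1
    simp at hP1
  have ha : ∀ ξ : Euc n, ξ ≠ 0 → Function.Injective (∑ i, ξ i • coeffMap A i : V →L[ℝ] W) := by
    intro ξ hξ v w hvw
    apply hA ξ hξ
    rw [symbol_eq_sum, symbol_eq_sum]
    simpa using hvw
  obtain ⟨η, hη1, hK⟩ := kernel_exists (coeffMap A) ha
  set b := stdOrthonormalBasis ℝ V with hb
  set d := Module.finrank ℝ V with hd
  set ε : ℝ≥0∞ := ENNReal.ofReal (1 / (2 * (d + 1))) with hε
  have hε0 : 0 < ε := by
    rw [hε, ENNReal.ofReal_pos]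
    positivity
  have hcomp : ∀ i : Fin d, ∃ C : ℝ≥0∞, C ≠ ⊤ ∧ ∀ u : Euc n → V, ContDiff ℝ (⊤ : ℕ∞) u →
      HasCompactSupport u → tsupport u ⊆ ball (0 : Euc n) 1 →
      eLpNorm (fun x => (innerSL ℝ (b i) (u x) : ℂ)) P μ
        ≤ ε * eLpNorm u P μ + C * ∫⁻ z, ‖opApply A u z‖ₑ := by
    intro i
    obtain ⟨K, hKK⟩ := hK (innerSL ℝ (b i))
    exact component_bound hn A η (innerSL ℝ (b i)) K hη1 hKK p hp1 hp2 ε hε0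
  choose C hCt hC using hcomp
  refine ⟨2 * (∑ i, C i).toReal + 1, by positivity, ?_⟩
  intro u hu huc hus
  have huC : Continuous u := hu.continuous
  have hmem : MemLp u P μ := (huC.memLp_of_hasCompactSupport huc).restrict _
  set f := opApply A u with hf
  have hfeq : f = fun x => ∑ i, coeffMap A i (fderiv ℝ u x (EuclideanSpace.single i 1)) := by
    ext x; exact opApply_eq_sum A u x
  have hfC : Continuous f := by
    rw [hfeq]
    have := hu.continuous_fderiv (by simp)
    fun_prop
  have hfs : Function.support f ⊆ tsupport u := by
    intro x hx
    by_contra hxu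
    apply hx
    have h0 : fderiv ℝ u x = 0 := by
      by_contra h
      exact hxu (support_fderiv_subset ℝ (f := u) h)
    rw [hfeq]
    simp [h0]
  have hfcs : HasCompactSupport f :=
    huc.of_isClosed_subset (isClosed_tsupport f) (closure_minimal hfs (isClosed_tsupport u))
  have hfi : Integrable f μ := (hfC.integrable_of_hasCompactSupport hfcs).restrict
  have hN : ∫⁻ z, ‖f z‖ₑ = ENNReal.ofReal (∫ x, ‖f x‖ ∂μ) := by
    rw [ofReal_integral_norm_eq_lintegral_enorm hfi, hμ, setLIntegral_eq_of_support_subset]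
    intro x hx
    apply hus
    apply hfs
    rw [Function.mem_support] at hx ⊢
    intro h0
    exact hx (by simp [h0])
  have hI0 : 0 ≤ ∫ x, ‖f x‖ ∂μ := integral_nonneg fun x => norm_nonneg _
  have hpt : ∀ x, ‖u x‖ ≤ ‖∑ i, (fun i => ‖(innerSL ℝ (b i) (u x) : ℂ)‖) i‖ := by
    intro x
    rw [Real.norm_of_nonneg (Finset.sum_nonneg fun i _ => norm_nonneg _)]
    conv_lhs => rw [← b.sum_repr' (u x)]
    refine (norm_sum_le _ _).trans (Finset.sum_le_sum fun i _ => ?_)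
    rw [norm_smul, b.orthonormal.1 i, mul_one, Complex.norm_real, innerSL_apply_apply]
  have hmain : eLpNorm u P μ ≤ ∑ i, (ε * eLpNorm u P μ + C i * ∫⁻ z, ‖f z‖ₑ) := by
    calc eLpNorm u P μ
        ≤ eLpNorm (∑ i, fun x => ‖(innerSL ℝ (b i) (u x) : ℂ)‖) P μ := by
          refine eLpNorm_mono fun x => ?_
          rw [Finset.sum_apply]
          exact hpt x
      _ ≤ ∑ i, eLpNorm (fun x => ‖(innerSL ℝ (b i) (u x) : ℂ)‖) P μ := by
          refine eLpNorm_sum_le (fun i _ => ?_) hP1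
          apply Continuous.aestronglyMeasurable
          fun_prop
      _ ≤ _ := by
          refine Finset.sum_le_sum fun i _ => ?_
          rw [eLpNorm_norm]
          exact hC i u hu huc hus
  rw [Finset.sum_add_distrib, Finset.sum_const, Finset.card_univ,
    Fintype.card_fin, nsmul_eq_mul, hN, ← Finset.sum_mul] at hmain
  have hU : eLpNorm u P μ ≠ ⊤ := hmem.2.ne
  have hCs : (∑ i, C i) ≠ ⊤ := ENNReal.sum_ne_top.2 fun i _ => hCt i
  have hr := ENNReal.toReal_mono (by
    refine ENNReal.add_ne_top.2 ⟨ENNReal.mul_ne_top (ENNReal.natCast_ne_top d)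
      (ENNReal.mul_ne_top ENNReal.ofReal_ne_top hU), ENNReal.mul_ne_top hCs ENNReal.ofReal_ne_top⟩) hmain
  rw [ENNReal.toReal_add (ENNReal.mul_ne_top (ENNReal.natCast_ne_top d)
      (ENNReal.mul_ne_top ENNReal.ofReal_ne_top hU)) (ENNReal.mul_ne_top hCs ENNReal.ofReal_ne_top),
    ENNReal.toReal_mul, ENNReal.toReal_mul, ENNReal.toReal_mul, ENNReal.toReal_natCast,
    ENNReal.toReal_ofReal (by positivity), ENNReal.toReal_ofReal hI0] at hr
  have hlhs : (∫ x, ‖u x‖ ^ p ∂μ) ^ (1 / p) = (eLpNorm u P μ).toReal := by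
    rw [hmem.eLpNorm_eq_integral_rpow_norm hP0 ENNReal.ofReal_ne_top, e1, one_div,
      ENNReal.toReal_ofReal]
    exact Real.rpow_nonneg (integral_nonneg fun x => Real.rpow_nonneg (norm_nonneg _) _) _
  rw [hlhs]
  set U := (eLpNorm u P μ).toReal with hUdef
  have hU0 : 0 ≤ U := ENNReal.toReal_nonneg
  have hd1 : (d : ℝ) * (1 / (2 * (d + 1)) * U) ≤ 1 / 2 * U := by
    rw [← mul_assoc]
    gcongr
    rw [mul_one_div, div_le_div_iff₀ (by positivity) (by norm_num)]
    linarith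
  nlinarith
end
end
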